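/- arXiv:1009.2199 — 4 statements merged into one kernel-verified Lean document; each statement's English description precedes it below -/
import Mathlib

section
/- Fix a lattice game G = (Γ, B) played on a cone, meaning the game board B is the complement of the (finite) set of defeated positions in the normal affine semigroup Λ = C ∩ ℤ^d, and let 𝒫 be its set of P-positions. If the indistinguishability relation ∼ on Λ has only finitely many equivalence classes (i.e., the misère quotient Λ/∼ is finite), then 𝒫 possesses an affine stratification. -/
open Pointwise

/-- An affine stratification of `W ⊆ ℤ^d`: a finite partition of `W` into pairwise
disjoint sets, each of the form `F + A` for a finite set `F ⊆ ℤ^d` and a finitely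
generated submonoid (affine semigroup) `A ⊆ ℤ^d`. -/
def IsAffineStratification {d : ℕ} (W : Set (Fin d → ℤ)) : Prop :=
  ∃ (r : ℕ) (F : Fin r → Finset (Fin d → ℤ)) (A : Fin r → AddSubmonoid (Fin d → ℤ)),
    (∀ i, (A i).FG) ∧
    (Pairwise fun i j => Disjoint
      ((F i : Set (Fin d → ℤ)) + (A i : Set (Fin d → ℤ)))
      ((F j : Set (Fin d → ℤ)) + (A j : Set (Fin d → ℤ)))) ∧
    W = ⋃ i, ((F i : Set (Fin d → ℤ)) + (A i : Set (Fin d → ℤ)))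

/-- Indistinguishability of positions `p, q ∈ ℤ^d` relative to the recession cone
`C` and the set `Pos` of P-positions: `p + r ∈ Pos ⟺ q + r ∈ Pos` for all lattice
points `r` of `C`. -/
def Indist {d : ℕ} (C : Set (Fin d → ℝ)) (Pos : Set (Fin d → ℤ)) (p q : Fin d → ℤ) : Prop :=
  ∀ r : Fin d → ℤ, (fun j => (r j : ℝ)) ∈ C → (p + r ∈ Pos ↔ q + r ∈ Pos)

theorem IsAffineStratification.of_finite {d : ℕ} {W : Set (Fin d → ℤ)} {ι : Type*} [Finite ι]
    (F : ι → Finset (Fin d → ℤ)) (A : ι → AddSubmonoid (Fin d → ℤ)) (hA : ∀ i, (A i).FG)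
    (hdisj : Pairwise fun i j => Disjoint
      ((F i : Set (Fin d → ℤ)) + (A i : Set (Fin d → ℤ)))
      ((F j : Set (Fin d → ℤ)) + (A j : Set (Fin d → ℤ))))
    (hW : W = ⋃ i, ((F i : Set (Fin d → ℤ)) + (A i : Set (Fin d → ℤ)))) :
    IsAffineStratification W := by
  obtain ⟨r, ⟨e⟩⟩ := Finite.exists_equiv_fin ι
  refine ⟨r, F ∘ e.symm, A ∘ e.symm, fun i => hA _,
    fun i j hij => hdisj (e.symm.injective.ne hij), ?_⟩
  rw [hW]
  exact (e.symm.surjective.iUnion_comp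
    (fun i => (F i : Set (Fin d → ℤ)) + (A i : Set (Fin d → ℤ)))).symm

/-- Truncation of a natural number: the identity below `M`, reduction modulo `N` to the window
`[M, M + N)` from `M` on. -/
def truncMod (M N x : ℕ) : ℕ := if x < M then x else M + (x - M) % N

theorem truncMod_lt {M N : ℕ} (hN : 0 < N) (x : ℕ) : truncMod M N x < M + N := by
  unfold truncMod
  have := Nat.mod_lt (x - M) hN
  split_ifs <;> omega

theorem exists_eq_truncMod_add (M N x : ℕ) :
    ∃ w, x = truncMod M N x + if M ≤ truncMod M N x then N * w else 0 := by
  unfold truncMod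
  by_cases h : x < M
  · exact ⟨0, by simp [h]⟩
  · refine ⟨(x - M) / N, ?_⟩
    have := Nat.mod_add_div (x - M) N
    simp only [h, if_false, Nat.le_add_right, if_true]
    omega

theorem truncMod_add {M N c : ℕ} (hc : c < M + N) (w : ℕ) :
    truncMod M N (c + if M ≤ c then N * w else 0) = c := by
  unfold truncMod
  by_cases h : M ≤ c
  · have h1 : c + N * w - M = (c - M) + N * w := by omega
    have h2 : ¬ c + N * w < M := by omega
    simp only [h, if_true, h2, if_false, h1, Nat.add_mul_mod_self_left]
    rw [Nat.mod_eq_of_lt (by omega)]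
    omega
  · simp only [h, if_false, add_zero]
    simp [not_le.mp h]

/-- The homomorphism multiplying by `N` the coordinates at which `c` is at least `M` and
annihilating the others. -/
def thresholdScale {n : ℕ} (M N : ℕ) (c : Fin n → ℕ) : (Fin n → ℕ) →+ (Fin n → ℕ) where
  toFun w i := if M ≤ c i then N * w i else 0
  map_zero' := by ext i; simp
  map_add' v w := by
    ext i
    by_cases h : M ≤ c i <;> simp [h, mul_add]

/-- The image of an ultimately periodic subset of `ℕ^n` under an additive map that is injective
on it has an affine stratification. -/
theorem isAffineStratification_image {d n : ℕ} (φ : (Fin n → ℕ) →+ (Fin d → ℤ))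
    (T : Set (Fin n → ℕ)) (hφ : Set.InjOn φ T) (M N : ℕ) (hN : 0 < N)
    (hT : ∀ c w, c + thresholdScale M N c w ∈ T ↔ c ∈ T) :
    IsAffineStratification (φ '' T) := by
  classical
  let ι := {c : Fin n → Fin (M + N) // (fun i => (c i : ℕ)) ∈ T}
  let v : ι → Fin n → ℕ := fun c i => c.1 i
  have hmem : ∀ (c : ι) (x : Fin d → ℤ),
      x ∈ ((({φ (v c)} : Finset (Fin d → ℤ)) : Set (Fin d → ℤ)) +
        ((AddMonoidHom.mrange (φ.comp (thresholdScale M N (v c)))) : Set (Fin d → ℤ))) ↔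
        ∃ w, φ (v c + thresholdScale M N (v c) w) = x := by
    intro c x
    simp [← eq_sub_iff_add_eq', sub_eq_neg_add]
  refine IsAffineStratification.of_finite (ι := ι) (fun c => {φ (v c)})
    (fun c => AddMonoidHom.mrange (φ.comp (thresholdScale M N (v c)))) (fun c => ?_) (fun c c' hne => ?_) ?_
  · rw [AddMonoidHom.mrange_eq_map]
    exact AddSubmonoid.FG.map (AddMonoid.FG.fg_top) _
  · refine Set.disjoint_left.2 ?_
    intro x hx hx'
    obtain ⟨w, rfl⟩ := (hmem _ _).1 hx
    obtain ⟨w', hw⟩ := (hmem _ _).1 hx'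
    have heq := hφ ((hT _ _).2 c'.2) ((hT _ _).2 c.2) hw
    refine hne (Subtype.ext (funext fun i => Fin.ext ?_))
    have hi := congrArg (truncMod M N) (congrFun heq i)
    exact ((truncMod_add (c'.1 i).2 (w' i)).symm.trans
      (hi.trans (truncMod_add (c.1 i).2 (w i)))).symm
  · ext x
    rw [Set.mem_iUnion]
    constructor
    · rintro ⟨u, hu, rfl⟩
      choose w hw using fun i => exists_eq_truncMod_add M N (u i)
      let c : Fin n → Fin (M + N) := fun i => ⟨truncMod M N (u i), truncMod_lt hN _⟩
      have huc : u = (fun i => (c i : ℕ)) + thresholdScale M N (fun i => (c i : ℕ)) w :=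
        funext hw
      refine ⟨⟨c, (hT _ w).1 (huc ▸ hu)⟩, (hmem _ _).2 ⟨w, ?_⟩⟩
      exact congrArg φ huc.symm
    · rintro ⟨c, hx⟩
      obtain ⟨w, rfl⟩ := (hmem _ _).1 hx
      exact ⟨_, (hT _ _).2 c.2, rfl⟩

theorem exists_nsmul_add_eq_nsmul (Q : Type*) [AddCommMonoid Q] [Finite Q] :
    ∃ M N : ℕ, 0 < N ∧ ∀ k, M ≤ k → ∀ w, ∀ q : Q, (k + N * w) • q = k • q := by
  obtain ⟨a, b, hab, hf⟩ :=
    Finite.exists_ne_map_eq_of_infinite (fun k : ℕ => (fun q : Q => k • q))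
  wlog hlt : a < b generalizing a b
  · exact this b a hab.symm hf.symm (by omega)
  refine ⟨a, b - a, by omega, fun k hk w q => ?_⟩
  induction w with
  | zero => simp
  | succ w ih =>
    have h1 : k + (b - a) * (w + 1) = b + (k - a + (b - a) * w) := by
      rw [mul_add]; omega
    have h2 : k + (b - a) * w = a + (k - a + (b - a) * w) := by omega
    rw [h1, add_nsmul, ← show a • q = b • q from congrFun hf q, ← add_nsmul, ← h2, ih]

/-- An upper set of `ℕ^n` is insensitive to the values of the coordinates above some bound. -/
theorem IsUpperSet.exists_threshold {n : ℕ} {U : Set (Fin n → ℕ)} (hU : IsUpperSet U) :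
    ∃ M : ℕ, ∀ u v : Fin n → ℕ, u ∈ U → (∀ i, v i < u i → M ≤ v i) → v ∈ U := by
  have hfin : {m | Minimal (· ∈ U) m}.Finite :=
    WellQuasiOrderedLE.finite_of_isAntichain (setOfPred_minimal_antichain _)
  obtain ⟨b, hb⟩ := hfin.bddAbove
  refine ⟨∑ i, b i, fun u v hu huv => ?_⟩
  obtain ⟨m, hmu, hm⟩ := exists_minimal_le_of_wellFoundedLT (· ∈ U) u hu
  refine hU (fun i => ?_) hm.prop
  by_cases h : v i < u i
  · exact (hb hm i).trans ((Finset.single_le_sum (fun _ _ => Nat.zero_le _)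
      (Finset.mem_univ i)).trans (huv i h))
  · exact (hmu i).trans (not_lt.mp h)

/-- Subsets of a finitely generated submonoid of `ℤ^d` that are recognized by a homomorphism to a
finite monoid have an affine stratification. -/
theorem isAffineStratification_preimage {d : ℕ} (L : AddSubmonoid (Fin d → ℤ)) (hL : L.FG)
    {Q : Type*} [AddCommMonoid Q] [Finite Q] (π : L →+ Q) (S : Set Q) :
    IsAffineStratification ((fun x : L => (x : Fin d → ℤ)) '' (π ⁻¹' S)) := by
  have : AddMonoid.FG L := (AddMonoid.fg_iff_addSubmonoid_fg L).2 hL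
  have : Module.Finite ℕ L := Module.Finite.iff_addMonoid_fg.2 this
  obtain ⟨n, f, hf⟩ := Module.Finite.exists_fin' ℕ L
  let U : Set (Fin n → ℕ) := {u | ∃ v, f v = f u ∧ toLex v < toLex u}
  have hU : IsUpperSet U := by
    rintro u u' huu ⟨v, hv, hlt⟩
    obtain ⟨w, rfl⟩ := exists_add_of_le huu
    refine ⟨v + w, by simp [hv], ?_⟩
    rw [toLex_add, toLex_add]
    exact add_lt_add_left hlt _
  obtain ⟨M₁, hM₁⟩ := hU.exists_threshold
  obtain ⟨M₂, N, hN, hM₂⟩ := exists_nsmul_add_eq_nsmul Q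
  let φ : (Fin n → ℕ) →+ (Fin d → ℤ) := L.subtype.comp f.toAddMonoidHom
  have hfφ : ∀ u v, φ u = φ v → f u = f v := fun u v h => Subtype.ext h
  let T : Set (Fin n → ℕ) := {u | u ∉ U ∧ π (f u) ∈ S}
  have himg : (fun x : L => (x : Fin d → ℤ)) '' (π ⁻¹' S) = φ '' T := by
    ext x
    constructor
    · rintro ⟨y, hy, rfl⟩
      obtain ⟨u, rfl⟩ := hf y
      obtain ⟨m, hm, hmin⟩ := WellFounded.has_min
        (wellFounded_lt : WellFounded ((· < ·) : Lex (Fin n → ℕ) → Lex (Fin n → ℕ) → Prop))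
        {v | f (ofLex v) = f u} ⟨toLex u, rfl⟩
      have hm' : f (ofLex m) = f u := hm
      refine ⟨ofLex m, ⟨?_, ?_⟩, congrArg Subtype.val hm'⟩
      · rintro ⟨v, hv, hlt⟩
        exact hmin (toLex v) (hv.trans hm') hlt
      · rw [hm']; exact hy
    · rintro ⟨u, hu, rfl⟩
      exact ⟨f u, hu.2, rfl⟩
  rw [himg]
  refine isAffineStratification_image φ T ?_ (max M₁ M₂) N hN fun c w => ?_
  · intro u hu v hv huv
    rcases lt_trichotomy (toLex u) (toLex v) with h | h | h
    · exact (hv.1 ⟨u, hfφ _ _ huv, h⟩).elim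
    · exact toLex.injective h
    · exact (hu.1 ⟨v, (hfφ _ _ huv).symm, h⟩).elim
  · set s := thresholdScale (max M₁ M₂) N c w with hs
    have hsi : ∀ i, s i = if max M₁ M₂ ≤ c i then N * w i else 0 := fun i => rfl
    have h1 : c + s ∈ U ↔ c ∈ U := by
      refine ⟨fun h => hM₁ _ _ h fun i hi => ?_, fun h => hU le_self_add h⟩
      rw [Pi.add_apply, hsi] at hi
      split_ifs at hi with hc
      · exact (le_max_left _ _).trans hc
      · simp at hi
    have hsum : ∀ u, π (f u) = ∑ i, u i • π (f (Pi.single i 1)) := by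
      intro u
      conv_lhs => rw [pi_eq_sum_univ' u]
      simp only [map_sum, map_nsmul]
    have h2 : π (f (c + s)) = π (f c) := by
      rw [hsum, hsum]
      refine Finset.sum_congr rfl fun i _ => ?_
      rw [Pi.add_apply, hsi]
      split_ifs with hc
      · exact hM₂ _ ((le_max_right _ _).trans hc) _ _
      · simp
    simp only [T, Set.mem_ofPred_eq, h1, h2]

/-- **Gordan's lemma**: the lattice points of a rational polyhedral cone form a finitely generated
monoid. -/
theorem addSubmonoid_fg_of_rational_cone {d k : ℕ} (cv : Fin k → Fin d → ℚ)
    (L : AddSubmonoid (Fin d → ℤ))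
    (hL : ∀ x : Fin d → ℤ, x ∈ L ↔ ∃ c : Fin k → ℝ, (∀ i, 0 ≤ c i) ∧
      (fun j => (x j : ℝ)) = ∑ i, c i • fun j => ((cv i j : ℝ))) : L.FG := by
  classical
  obtain ⟨b, hb, hz⟩ : ∃ b : ℕ, 0 < b ∧ ∀ i j, ∃ z : ℤ, (z : ℝ) = b * (cv i j : ℝ) := by
    refine ⟨∏ p : Fin k × Fin d, (cv p.1 p.2).den,
      Finset.prod_pos fun p _ => (cv p.1 p.2).pos, fun i j => ?_⟩
    obtain ⟨e, he⟩ := Finset.dvd_prod_of_mem (fun p : Fin k × Fin d => (cv p.1 p.2).den)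
      (Finset.mem_univ (i, j))
    refine ⟨e * (cv i j).num, ?_⟩
    have h : ((cv i j).num : ℚ) = cv i j * (cv i j).den := (Rat.mul_den_eq_num _).symm
    have h' : ((cv i j).num : ℝ) = cv i j * (cv i j).den := by exact_mod_cast h
    rw [he]
    push_cast
    rw [h']
    ring
  choose z hz using hz
  have hb' : (0 : ℝ) < b := by exact_mod_cast hb
  have hzL : ∀ i, z i ∈ L := fun i => (hL _).2 ⟨Pi.single i b, fun i' => by
      by_cases h : i' = i
      · subst h; simp
      · simp [h], by
      ext j
      rw [Finset.sum_eq_single i] <;> simp +contextual [hz]⟩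
  let K : Fin d → ℤ := fun j => ∑ i, |z i j|
  have hfin : ((L : Set (Fin d → ℤ)) ∩ Set.Icc (-K) K).Finite :=
    (Set.finite_Icc _ _).inter_of_right _
  refine (AddSubmonoid.fg_iff _).2 ⟨Set.range z ∪ ((L : Set (Fin d → ℤ)) ∩ Set.Icc (-K) K),
    le_antisymm ?_ fun x hx => ?_, (Set.finite_range z).union hfin⟩
  · rw [AddSubmonoid.closure_le]
    rintro x (⟨i, rfl⟩ | hx)
    exacts [hzL i, hx.1]
  · obtain ⟨c, hc, hxc⟩ := (hL x).1 hx
    let y : Fin d → ℤ := x - ∑ i, ⌊c i / b⌋₊ • z i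
    have hxy : x = y + ∑ i, ⌊c i / b⌋₊ • z i := by simp [y]
    have hyj : ∀ j, (y j : ℝ) = ∑ i, (c i / b - ⌊c i / b⌋₊) * z i j := by
      intro j
      have := congrFun hxc j
      simp only [Finset.sum_apply, Pi.smul_apply, smul_eq_mul] at this
      simp only [y, Pi.sub_apply, Finset.sum_apply, Pi.smul_apply]
      simp only [nsmul_eq_mul]
      push_cast
      rw [this, ← Finset.sum_sub_distrib]
      refine Finset.sum_congr rfl fun i _ => ?_
      rw [hz]
      field_simp
    have h0 : ∀ i, 0 ≤ c i / b - ⌊c i / b⌋₊ := fun i =>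
      sub_nonneg.2 (Nat.floor_le (div_nonneg (hc i) hb'.le))
    have h1 : ∀ i, c i / b - ⌊c i / b⌋₊ ≤ 1 := fun i => by
      linarith [Nat.lt_floor_add_one (c i / b)]
    have hyL : y ∈ L := by
      refine (hL y).2 ⟨fun i => (c i / b - ⌊c i / b⌋₊) * b,
        fun i => mul_nonneg (h0 i) hb'.le, ?_⟩
      ext j
      rw [hyj]
      simp [hz, mul_assoc]
    have hyK : ∀ j, |y j| ≤ K j := by
      intro j
      have : (|y j| : ℝ) ≤ ∑ i, (|z i j| : ℝ) := by
        rw [hyj]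
        refine (Finset.abs_sum_le_sum_abs _ _).trans (Finset.sum_le_sum fun i _ => ?_)
        rw [abs_mul, abs_of_nonneg (h0 i)]
        exact mul_le_of_le_one_left (abs_nonneg _) (h1 i)
      exact_mod_cast this
    rw [hxy]
    refine add_mem (AddSubmonoid.subset_closure (Or.inr ⟨hyL, fun j => (abs_le.1 (hyK j)).1,
      fun j => (abs_le.1 (hyK j)).2⟩)) (sum_mem fun i _ => nsmul_mem ?_ _)
    exact AddSubmonoid.subset_closure (Or.inl ⟨i, rfl⟩)

/-- A lattice game `G = (Γ, B)` played on a cone: the board `B` is the complement of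
the finite set of defeated positions in the normal affine semigroup `Λ = C ∩ ℤ^d`,
where `C` is a pointed rational polyhedral cone of dimension `d`.  If the misère
quotient `Λ/∼` is finite (the indistinguishability relation `∼` has finitely many
classes), then the set `Pos` of P-positions of `G` possesses an affine
stratification. -/
theorem lattice_game_on_cone_finite_misere_quotient_isAffineStratification {d : ℕ}
    (k : ℕ) (cv : Fin k → (Fin d → ℚ))
    (C : Set (Fin d → ℝ))
    -- C is a pointed rational polyhedral cone of dimension d
    (hC : C = {x | ∃ c : Fin k → ℝ, (∀ i, 0 ≤ c i) ∧
      x = ∑ i, c i • fun j => ((cv i j : ℝ))})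
    (hpointed : C ∩ (-C) = {(0 : Fin d → ℝ)})
    (hdim : Submodule.span ℝ C = ⊤)
    -- Λ = C ∩ ℤ^d is a normal affine semigroup
    (Λ : Set (Fin d → ℤ)) (hΛ : Λ = {x : Fin d → ℤ | (fun j => (x j : ℝ)) ∈ C})
    -- Γ is a rule set
    (Γ : Finset (Fin d → ℤ)) (hΓ0 : (0 : Fin d → ℤ) ∉ Γ)
    (ℓ : (Fin d → ℝ) →ₗ[ℝ] ℝ)
    (hℓΓ : ∀ γ ∈ Γ, 0 < ℓ (fun j => (γ j : ℝ)))
    (hℓC : ∀ x ∈ C, x ≠ 0 → 0 < ℓ x)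
    (F : Finset (Fin d → ℤ)) (hFΛ : (F : Set (Fin d → ℤ)) ⊆ Λ)
    (hpath : ∀ p ∈ Λ, ∃ (r : ℕ) (seq : ℕ → (Fin d → ℤ)),
      seq r = p ∧ seq 0 ∈ F ∧ (∀ i ≤ r, seq i ∈ Λ) ∧
      ∀ i < r, seq (i + 1) - seq i ∈ Γ)
    -- B = Λ ∖ D is a game board: D is a finite Γ-order ideal of defeated positions
    (D : Finset (Fin d → ℤ)) (hDΛ : (D : Set (Fin d → ℤ)) ⊆ Λ)
    (hD : ∀ p ∈ Λ, ∀ q ∈ D, q - p ∈ AddSubmonoid.closure (Γ : Set (Fin d → ℤ)) → p ∈ D)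
    (B : Set (Fin d → ℤ)) (hB : B = Λ \ (D : Set (Fin d → ℤ)))
    -- Pos is the set of P-positions
    (Pos : Set (Fin d → ℤ)) (hPosB : Pos ⊆ B)
    (hPos : (Pos + (Γ : Set (Fin d → ℤ))) ∩ B = B \ Pos)
    -- the misère quotient Λ/∼ is finite
    (hfin : Finite (Quot fun p q : {x : Fin d → ℤ // x ∈ Λ} =>
      Indist C Pos (p : Fin d → ℤ) (q : Fin d → ℤ))) :
    IsAffineStratification Pos := by
  have hadd : ∀ x ∈ C, ∀ y ∈ C, x + y ∈ C := by
    subst hC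
    rintro _ ⟨a, ha, rfl⟩ _ ⟨b, hb, rfl⟩
    exact ⟨a + b, fun i => add_nonneg (ha i) (hb i), by
      simp [add_smul, Finset.sum_add_distrib]⟩
  have hzero : (0 : Fin d → ℝ) ∈ C := by
    rw [hC]
    exact ⟨0, fun i => le_rfl, by simp⟩
  let L : AddSubmonoid (Fin d → ℤ) :=
    { carrier := Λ
      zero_mem' := by
        rw [hΛ]
        simpa [← Pi.zero_def] using hzero
      add_mem' := by
        intro x y hx hy
        rw [hΛ] at hx hy ⊢
        have := hadd _ hx _ hy
        simpa [Pi.add_def] using this }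
  have hLC : ∀ x : Fin d → ℤ, x ∈ L ↔ (fun j => (x j : ℝ)) ∈ C := fun x => by
    change x ∈ Λ ↔ _
    rw [hΛ]; rfl
  have hLfg : L.FG := addSubmonoid_fg_of_rational_cone cv L fun x => by
    rw [hLC, hC]; rfl
  have hind : ∀ p q : Fin d → ℤ, Indist C Pos p q → ∀ r ∈ L, Indist C Pos (p + r) (q + r) := by
    intro p q h r hr s hs
    rw [add_assoc, add_assoc]
    exact h _ ((hLC _).1 (add_mem hr ((hLC s).2 hs)))
  let con : AddCon L :=
    { r := fun p q => Indist C Pos (p : Fin d → ℤ) (q : Fin d → ℤ)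
      iseqv :=
        ⟨fun _ _ _ => Iff.rfl, fun h r hr => (h r hr).symm,
          fun h h' r hr => (h r hr).trans (h' r hr)⟩
      add' := by
        intro p q r s hpq hrs t ht
        have h1 := hind _ _ hpq _ r.2 t ht
        have h2 := hind _ _ hrs _ q.2 t ht
        rw [add_comm (r : Fin d → ℤ), add_comm (s : Fin d → ℤ)] at h2
        exact h1.trans h2 }
  have hQ : Finite con.Quotient := hfin
  have hstrat := isAffineStratification_preimage L hLfg con.mk'
    (con.mk' '' {p | (p : Fin d → ℤ) ∈ Pos})
  convert hstrat using 1
  ext x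
  constructor
  · intro hx
    have hxL : x ∈ Λ := by
      have := hPosB hx
      rw [hB] at this
      exact this.1
    exact ⟨⟨x, hxL⟩, ⟨⟨x, hxL⟩, hx, rfl⟩, rfl⟩
  · rintro ⟨p, ⟨q, hq, hqp⟩, rfl⟩
    have h : Indist C Pos (q : Fin d → ℤ) (p : Fin d → ℤ) := con.eq.1 hqp
    simpa using (h 0 (by simpa [← Pi.zero_def] using hzero)).1 (by simpa using hq)
end

section
/- For a set W ⊆ ℤ^d the following six conditions are equivalent: (1) W possesses an affine stratification; (2) W is a finite (not necessarily disjoint) union of sets Wᵢ, each a finitely generated module Fᵢ + Aᵢ (Fᵢ finite) over an affine semigroup Aᵢ ⊆ ℤ^d; (3) W is a finite (not necessarily disjoint) union of translates fᵢ + Aᵢ of affine semigroups Aᵢ ⊆ ℤ^d; (4) W is a finite (not necessarily disjoint) union of translates fᵢ + Aᵢ of normal affine semigroups Aᵢ ⊆ ℤ^d; (5) W is a finite disjoint union of translates fᵢ + Aᵢ of normal affine semigroups Aᵢ ⊆ ℤ^d; (6) W is a finite disjoint union of translates fᵢ + Aᵢ of (not necessarily normal) affine semigroups Aᵢ ⊆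 ℤ^d. -/
open Pointwise

/-- A normal affine semigroup: a finitely generated submonoid of `ℤ^d` that is
saturated in the subgroup it generates (equivalently, the intersection of a
rational polyhedral cone with a sublattice of `ℤ^d`). -/
def IsNormalAffineSemigroup {d : ℕ} (A : AddSubmonoid (Fin d → ℤ)) : Prop :=
  A.FG ∧ ∀ (n : ℕ) (x : Fin d → ℤ), 0 < n →
    x ∈ AddSubgroup.closure (A : Set (Fin d → ℤ)) → n • x ∈ A → x ∈ A

section

variable {M N G : Type*}

/-- A lower set in `ℕ^ι` is determined by its points with coordinates bounded by some `K`. -/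
theorem exists_mem_iff_inf_mem_of_isLowerSet {ι : Type*} [Finite ι] {s : Set (ι → ℕ)}
    (hs : IsLowerSet s) : ∃ K : ℕ, ∀ x, x ∈ s ↔ x ⊓ Function.const ι K ∈ s := by
  have hfin : {x | Minimal (· ∈ sᶜ) x}.Finite :=
    WellQuasiOrderedLE.finite_of_isAntichain (setOfPred_minimal_antichain _)
  obtain ⟨b, hb⟩ := hfin.bddAbove
  have := Fintype.ofFinite ι
  refine ⟨Finset.univ.sup b, fun x => ⟨fun h => hs inf_le_left h, fun h => ?_⟩⟩
  by_contra hx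
  obtain ⟨m, hmx, hm⟩ := exists_minimal_le_of_wellFoundedLT (· ∈ sᶜ) x hx
  refine hm.prop (hs (le_inf hmx fun i => ?_) h)
  exact (hb hm i).trans (Finset.le_sup (Finset.mem_univ i))

/-- A finitely generated module over an affine semigroup: a set of the form `F + A` with `F` finite
and `A` a finitely generated submonoid. -/
def IsFGModuleSet [AddCommMonoid M] (s : Set M) : Prop :=
  ∃ (F : Set M) (A : AddSubmonoid M), F.Finite ∧ A.FG ∧ s = F + (A : Set M)

namespace IsFGModuleSet

theorem of_fg [AddCommMonoid M] {A : AddSubmonoid M} (hA : A.FG) :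
    IsFGModuleSet (A : Set M) :=
  ⟨{0}, A, Set.finite_singleton 0, hA, by simp⟩

theorem vadd [AddCommMonoid M] {s : Set M} (hs : IsFGModuleSet s) (a : M) :
    IsFGModuleSet (a +ᵥ s) := by
  obtain ⟨F, A, hF, hA, rfl⟩ := hs
  exact ⟨a +ᵥ F, A, hF.vadd_set, hA, by rw [vadd_add_assoc]⟩

theorem image [AddCommMonoid M] [AddCommMonoid N] {s : Set M} (hs : IsFGModuleSet s)
    (f : M →+ N) : IsFGModuleSet (f '' s) := by
  obtain ⟨F, A, hF, hA, rfl⟩ := hs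
  exact ⟨f '' F, A.map f, hF.image f, hA.map f, by rw [Set.image_add]; rfl⟩

/-- The solutions of finitely many linear equations over `ℕ` differing in the constant term form a
finitely generated module over the monoid of solutions of the homogeneous equation. -/
theorem setOfPred_exists_eq_add [AddCommMonoid M] [PartialOrder M] [WellQuasiOrderedLE M]
    [IsOrderedCancelAddMonoid M] [CanonicallyOrderedAdd M] [AddCommGroup G] (f g : M →+ G)
    {C : Set G} (hC : C.Finite) : IsFGModuleSet {x | ∃ c ∈ C, f x = c + g x} := by
  refine ⟨⋃ c ∈ C, {x | Minimal (fun x => f x = c + g x) x}, f.eqLocusM g,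
    hC.biUnion fun c _ =>
      WellQuasiOrderedLE.finite_of_isAntichain (setOfPred_minimal_antichain _),
    AddSubmonoid.fg_eqLocusM f g, ?_⟩
  ext x
  simp only [Set.mem_add, Set.mem_iUnion]
  constructor
  · rintro ⟨c, hc, hx⟩
    obtain ⟨m, hmx, hm⟩ := exists_minimal_le_of_wellFoundedLT (fun x => f x = c + g x) x hx
    obtain ⟨y, rfl⟩ := exists_add_of_le hmx
    refine ⟨m, ⟨c, hc, hm⟩, y, ?_, rfl⟩
    have h := hm.prop
    rw [map_add, map_add, h, ← add_assoc] at hx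
    exact add_left_cancel hx
  · rintro ⟨m, ⟨c, hc, hm⟩, y, hy, rfl⟩
    have h₁ : f m = c + g m := (show Minimal (fun x => f x = c + g x) m from hm).prop
    have h₂ : f y = g y := hy
    exact ⟨c, hc, by simp [h₁, h₂, add_assoc]⟩

theorem range [AddCommMonoid M] [AddMonoid.FG M] [AddCommMonoid N] (f : M →+ N) :
    IsFGModuleSet (Set.range f) := by
  rw [← AddMonoidHom.coe_mrange, AddMonoidHom.mrange_eq_map]
  exact of_fg (AddMonoid.FG.fg_top.map f)

theorem exists_range [AddCommMonoid M] {s : Set M} (hs : IsFGModuleSet s) :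
    ∃ (F : Set M) (n : ℕ) (f : (Fin n → ℕ) →+ M), F.Finite ∧ s = F + Set.range f := by
  obtain ⟨F, A, hF, hA, rfl⟩ := hs
  obtain ⟨n, f, rfl⟩ := AddSubmonoid.fg_iff_exists_fin_addMonoidHom.1 hA
  exact ⟨F, n, f, hF, by simp⟩

/-- Preimages of finitely generated modules over affine semigroups under homomorphisms are again
such. -/
theorem preimage [AddCommMonoid M] [AddMonoid.FG M] [AddCommGroup G] {s : Set G}
    (hs : IsFGModuleSet s) (f : M →+ G) : IsFGModuleSet (f ⁻¹' s) := by
  obtain ⟨C, k, g, hC, rfl⟩ := hs.exists_range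
  obtain ⟨n, p, hp⟩ :=
    AddSubmonoid.fg_iff_exists_fin_addMonoidHom.1 (AddMonoid.FG.fg_top (M := M))
  rw [AddMonoidHom.mrange_eq_top] at hp
  convert (setOfPred_exists_eq_add ((f.comp p).comp (AddMonoidHom.fst (Fin n → ℕ) (Fin k → ℕ)))
    (g.comp (AddMonoidHom.snd (Fin n → ℕ) (Fin k → ℕ))) hC).image (p.comp (AddMonoidHom.fst _ _))
  ext x
  obtain ⟨u, rfl⟩ := hp x
  simp only [Set.mem_preimage, Set.mem_add, Set.mem_range, exists_exists_eq_and, Set.mem_image,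
    Set.mem_ofPred_eq, Prod.exists, AddMonoidHom.comp_apply, AddMonoidHom.coe_fst,
    AddMonoidHom.coe_snd]
  constructor
  · rintro ⟨c, hc, v, h⟩
    exact ⟨u, v, ⟨c, hc, h.symm⟩, rfl⟩
  · rintro ⟨w, v, ⟨c, hc, h⟩, hw⟩
    exact ⟨c, hc, v, by rw [← h, hw]⟩

end IsFGModuleSet

/-- A translate of a free finitely generated monoid. -/
def IsFreeTranslate [AddCommMonoid M] (s : Set M) : Prop :=
  ∃ (ι : Type) (_ : Finite ι) (a : M) (g : (ι → ℕ) →+ M),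
    Function.Injective g ∧ s = a +ᵥ Set.range g

theorem IsFreeTranslate.vadd [AddCommMonoid M] {s : Set M} (hs : IsFreeTranslate s) (a : M) :
    IsFreeTranslate (a +ᵥ s) := by
  obtain ⟨ι, _, b, g, hg, rfl⟩ := hs
  exact ⟨ι, ‹_›, a + b, g, hg, by rw [vadd_vadd]⟩

theorem IsFreeTranslate.inter [AddCommGroup G] {s t : Set G} (hs : IsFreeTranslate s)
    (ht : IsFreeTranslate t) : IsFGModuleSet (s ∩ t) := by
  obtain ⟨ι, _, a, f, -, rfl⟩ := hs
  obtain ⟨κ, _, b, g, -, rfl⟩ := ht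
  convert ((((IsFGModuleSet.range g).vadd (b - a)).preimage f).image f).vadd a
  ext x
  simp only [Set.mem_inter_iff, Set.mem_vadd_set, Set.mem_range, Set.mem_image, Set.mem_preimage,
    vadd_eq_add, exists_exists_eq_and]
  constructor
  · rintro ⟨⟨u, rfl⟩, v, hv⟩
    exact ⟨_, ⟨u, ⟨v, by rw [sub_add_eq_add_sub, hv]; abel⟩, rfl⟩, rfl⟩
  · rintro ⟨_, ⟨u, ⟨v, hv⟩, rfl⟩, rfl⟩
    exact ⟨⟨u, rfl⟩, v, by rw [← hv]; abel⟩

/-- A finite disjoint union of translates of free finitely generated monoids. -/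
def IsFreeStratified [AddCommMonoid M] (s : Set M) : Prop :=
  ∃ (κ : Type) (_ : Finite κ) (T : κ → Set M),
    (∀ k, IsFreeTranslate (T k)) ∧ Pairwise (Function.onFun Disjoint T) ∧ s = ⋃ k, T k

namespace IsFreeStratified

theorem vadd [AddCommGroup G] {s : Set G} (hs : IsFreeStratified s) (a : G) :
    IsFreeStratified (a +ᵥ s) := by
  obtain ⟨κ, _, T, hT, hd, rfl⟩ := hs
  refine ⟨κ, ‹_›, fun k => a +ᵥ T k, fun k => (hT k).vadd a, fun i j hij => ?_, ?_⟩
  · simpa [Function.onFun] using hd hij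
  · rw [Set.vadd_set_iUnion]

theorem iUnion [AddCommMonoid M] {κ : Type} [Finite κ] {s : κ → Set M}
    (hs : ∀ k, IsFreeStratified (s k)) (hd : Pairwise (Function.onFun Disjoint s)) :
    IsFreeStratified (⋃ k, s k) := by
  choose ι hι T hT hd' hU using hs
  refine ⟨Σ k, ι k, inferInstance, fun p => T p.1 p.2, fun p => hT _ _, ?_, ?_⟩
  · rintro ⟨i, x⟩ ⟨j, y⟩ hxy
    obtain rfl | hij := eq_or_ne i j
    · exact hd' i (by simpa using hxy)
    · refine (hd hij).mono ?_ ?_ <;> rw [hU] <;> exact Set.subset_iUnion _ _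
  · rw [Set.iUnion_sigma]
    exact Set.iUnion_congr hU

theorem union [AddCommMonoid M] {s t : Set M} (hs : IsFreeStratified s) (ht : IsFreeStratified t)
    (hd : Disjoint s t) : IsFreeStratified (s ∪ t) := by
  rw [Set.union_eq_iUnion]
  refine iUnion (fun b => by cases b <;> assumption) ?_
  intro i j hij
  cases i <;> cases j <;> simp_all [Function.onFun, disjoint_comm]

theorem empty [AddCommMonoid M] : IsFreeStratified (∅ : Set M) :=
  ⟨Empty, inferInstance, Empty.elim, fun k => k.elim, fun k => k.elim, by simp⟩

end IsFreeStratified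

theorem IsFGModuleSet.isFreeStratified [AddCancelCommMonoid M] {s : Set M} (hs : IsFGModuleSet s) :
    IsFreeStratified s := by
  obtain ⟨F, n, f, hF, rfl⟩ := hs.exists_range
  obtain ⟨r, c, -, rfl⟩ := hF.fin_param
  -- a monomial order on `ℕ^n × Fin r` singles out one preimage of each point
  let e (u : Fin n → ℕ) (i : Fin r) : Lex (Fin n → ℕ) ×ₗ Fin r := toLex (toLex u, i)
  have he : ∀ u i v j, e u i = e v j ↔ u = v ∧ i = j := by simp [e]
  let L (i : Fin r) : Set (Fin n → ℕ) := {u | ∀ v j, c j + f v = c i + f u → e u i ≤ e v j}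
  have hL : ∀ i, IsLowerSet (L i) := by
    intro i u v hvu hu w j hw
    obtain ⟨x, rfl⟩ := exists_add_of_le hvu
    have := hu (w + x) j (by rw [map_add, map_add, ← add_assoc, hw, add_assoc])
    simp only [e, Prod.Lex.toLex_le_toLex, toLex_add, add_lt_add_iff_right, add_left_inj] at this ⊢
    exact this
  have hLu : ∀ {i j u v}, u ∈ L i → v ∈ L j → c i + f u = c j + f v → u = v ∧ i = j :=
    fun hu hv h => (he _ _ _ _).1 ((hu _ _ h.symm).antisymm (hv _ _ h))
  choose K hK using fun i => exists_mem_iff_inf_mem_of_isLowerSet (hL i)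
  let Q (i : Fin r) := {q : Fin n → Fin (K i + 1) // (fun k => (q k : ℕ)) ∈ L i}
  let q {i : Fin r} (x : Q i) : Fin n → ℕ := fun k => x.1 k
  let J {i : Fin r} (x : Q i) := {k : Fin n // q x k = K i}
  let g {i : Fin r} (x : Q i) : (J x → ℕ) →+ (Fin n → ℕ) :=
    { toFun := fun u k => if h : q x k = K i then u ⟨k, h⟩ else 0
      map_zero' := by ext; simp
      map_add' := by intro u v; ext k; by_cases h : q x k = K i <;> simp [h] }
  have hg : ∀ {i} (x : Q i) (u : J x → ℕ),
      (q x + g x u) ⊓ Function.const _ (K i) = q x := by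
    intro i x u
    ext k
    have : q x k < K i + 1 := (x.1 k).is_lt
    by_cases h : q x k = K i
    · simp [g, h]
    · simp [g, h]
      omega
  have hgL : ∀ {i} (x : Q i) (u : J x → ℕ), q x + g x u ∈ L i := by
    intro i x u
    rw [hK, hg]
    exact x.2
  refine ⟨Σ i, Q i, inferInstance,
    fun x => (c x.1 + f (q x.2)) +ᵥ Set.range (f.comp (g x.2)), ?_, ?_, ?_⟩
  · rintro ⟨i, x⟩
    refine ⟨J x, inferInstance, _, _, fun u v huv => ?_, rfl⟩
    have := (hLu (hgL x u) (hgL x v) (by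
      rw [map_add, map_add]; exact congrArg (fun z => c i + (f (q x) + z)) huv)).1
    have := add_left_cancel this
    ext ⟨k, hk⟩
    simpa [g, hk] using congrFun this k
  · rintro ⟨i, x⟩ ⟨j, y⟩ hxy
    refine Set.disjoint_left.2 fun z hz hz' => hxy ?_
    obtain ⟨_, ⟨u, rfl⟩, rfl⟩ := hz
    obtain ⟨_, ⟨v, rfl⟩, hv⟩ := hz'
    obtain ⟨h, rfl⟩ := hLu (hgL x u) (hgL y v) (by
      simpa [add_assoc] using hv.symm)
    have h' : q x = q y := by rw [← hg x u, ← hg y v, h]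
    simp only [Sigma.mk.injEq, heq_eq_eq, true_and]
    exact Subtype.ext (funext fun k => Fin.ext (congrFun h' k))
  · ext z
    simp only [Set.mem_add, Set.mem_range, exists_exists_eq_and, Set.mem_iUnion, Set.mem_vadd_set,
      vadd_eq_add, Sigma.exists, AddMonoidHom.comp_apply]
    constructor
    · rintro ⟨j, v, rfl⟩
      obtain ⟨⟨u, i⟩, hui, hmin⟩ := exists_minimalFor_of_wellFoundedLT
        (fun p : (Fin n → ℕ) × Fin r => c p.2 + f p.1 = c j + f v) (fun p => e p.1 p.2) ⟨(v, j), rfl⟩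
      have hu : u ∈ L i := fun w k hw => by
        rcases le_total (e u i) (e w k) with h | h
        · exact h
        · exact hmin (j := (w, k)) (hw.trans hui) h
      have hlt : ∀ k, min (u k) (K i) < K i + 1 := fun k => by omega
      let x : Q i := ⟨fun k => ⟨min (u k) (K i), hlt k⟩, (hK i u).1 hu⟩
      refine ⟨i, x, fun k => u k - K i, ?_⟩
      rw [← hui, add_assoc, ← map_add]
      congr 2
      ext k
      by_cases h : K i ≤ u k
      · simp [g, q, x, h]
      · simp [g, q, x, h]
        omega
    · rintro ⟨i, x, u, rfl⟩
      exact ⟨i, q x + g x u, by rw [map_add, add_assoc]⟩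

namespace IsFreeStratified

variable [AddCommGroup G]

theorem inter {s t : Set G} (hs : IsFreeStratified s) (ht : IsFreeStratified t) :
    IsFreeStratified (s ∩ t) := by
  obtain ⟨ι, _, S, hS, hSd, rfl⟩ := hs
  obtain ⟨κ, _, T, hT, hTd, rfl⟩ := ht
  rw [Set.iUnion_inter_iUnion, ← Set.iUnion_prod' (fun p : ι × κ => S p.1 ∩ T p.2)]
  refine iUnion (fun p => ((hS p.1).inter (hT p.2)).isFreeStratified) ?_
  rintro ⟨i, j⟩ ⟨i', j'⟩ hij
  by_cases h : i = i'
  · subst h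
    exact (hTd (by simpa using hij)).mono Set.inter_subset_right Set.inter_subset_right
  · exact (hSd h).mono Set.inter_subset_left Set.inter_subset_left

end IsFreeStratified

/-- Both the set and its complement are finite disjoint unions of translates of free finitely
generated monoids. -/
def IsFreeBistratified [AddCommGroup G] (s : Set G) : Prop :=
  IsFreeStratified s ∧ IsFreeStratified sᶜ

namespace IsFreeBistratified

variable [AddCommGroup G] {s t : Set G}

theorem compl (hs : IsFreeBistratified s) : IsFreeBistratified sᶜ :=
  ⟨hs.2, by rw [compl_compl]; exact hs.1⟩

theorem inter (hs : IsFreeBistratified s) (ht : IsFreeBistratified t) :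
    IsFreeBistratified (s ∩ t) := by
  refine ⟨hs.1.inter ht.1, ?_⟩
  have : (s ∩ t)ᶜ = sᶜ ∪ (s ∩ tᶜ) := by ext; simp; tauto
  rw [this]
  exact hs.2.union (hs.1.inter ht.2)
    (Set.disjoint_left.2 fun _ h h' => h h'.1)

theorem union (hs : IsFreeBistratified s) (ht : IsFreeBistratified t) :
    IsFreeBistratified (s ∪ t) := by
  simpa [Set.compl_inter] using (hs.compl.inter ht.compl).compl

theorem vadd (hs : IsFreeBistratified s) (a : G) : IsFreeBistratified (a +ᵥ s) :=
  ⟨hs.1.vadd a, by rw [← Set.vadd_set_compl]; exact hs.2.vadd a⟩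

theorem empty [AddMonoid.FG G] : IsFreeBistratified (∅ : Set G) :=
  ⟨.empty, by
    simpa using (IsFGModuleSet.of_fg (AddMonoid.FG.fg_top (M := G))).isFreeStratified⟩

theorem iUnion [AddMonoid.FG G] {κ : Type*} [Finite κ] {s : κ → Set G}
    (hs : ∀ k, IsFreeBistratified (s k)) : IsFreeBistratified (⋃ k, s k) := by
  have := Fintype.ofFinite κ
  suffices ∀ F : Finset κ, IsFreeBistratified (⋃ k ∈ F, s k) by
    simpa using this Finset.univ
  classical
  intro F
  induction F using Finset.induction_on with
  | empty => simpa using empty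
  | insert k F _ ih =>
    rw [Finset.set_biUnion_insert]
    exact (hs k).union ih

theorem iInter [AddMonoid.FG G] {κ : Type*} [Finite κ] {s : κ → Set G}
    (hs : ∀ k, IsFreeBistratified (s k)) : IsFreeBistratified (⋂ k, s k) := by
  simpa [Set.compl_iUnion] using (iUnion fun k => (hs k).compl).compl

end IsFreeBistratified

theorem Int.isFGModuleSet_Ici_zero : IsFGModuleSet (Set.Ici (0 : ℤ)) := by
  convert IsFGModuleSet.range (Nat.castAddMonoidHom ℤ)
  ext x
  exact ⟨fun h => ⟨x.toNat, Int.toNat_of_nonneg h⟩, by rintro ⟨n, rfl⟩; simp⟩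

theorem Int.isFGModuleSet_Iio_zero : IsFGModuleSet (Set.Iio (0 : ℤ)) := by
  convert (IsFGModuleSet.range (-Nat.castAddMonoidHom ℤ)).vadd (-1)
  ext x
  simp only [Set.mem_Iio, Set.mem_vadd_set, Set.mem_range, exists_exists_eq_and, vadd_eq_add,
    AddMonoidHom.neg_apply, Nat.coe_castAddMonoidHom]
  exact ⟨fun h => ⟨(-x - 1).toNat, by omega⟩, by rintro ⟨n, rfl⟩; omega⟩

theorem Int.isFGModuleSet_setOfPred_emod_mem {m : ℤ} (hm : 0 < m) (R : Set ℤ) :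
    IsFGModuleSet {x : ℤ | x % m ∈ R} := by
  refine ⟨R ∩ Set.Ico 0 m, AddMonoidHom.mrange (zmultiplesHom ℤ m),
    (Set.finite_Ico 0 m).inter_of_right R, ?_, ?_⟩
  · rw [AddMonoidHom.mrange_eq_map]
    exact AddMonoid.FG.fg_top.map _
  · ext x
    simp only [Set.mem_ofPred_eq, Set.mem_add, Set.mem_inter_iff, Set.mem_Ico, SetLike.mem_coe,
      AddMonoidHom.mem_mrange, exists_exists_eq_and, zmultiplesHom_apply, smul_eq_mul]
    constructor
    · intro h
      exact ⟨x % m, ⟨h, Int.emod_nonneg _ hm.ne', Int.emod_lt_of_pos _ hm⟩, x / m,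
        Int.emod_add_ediv_mul x m⟩
    · rintro ⟨r, ⟨hr, h0, h1⟩, k, rfl⟩
      rwa [Int.add_mul_emod_self_right, Int.emod_eq_of_lt h0 h1]

namespace IsFreeBistratified

variable [AddCommGroup G] [AddMonoid.FG G]

theorem preimage {s : Set ℤ} (hs : IsFGModuleSet s) (hs' : IsFGModuleSet sᶜ) (φ : G →+ ℤ) :
    IsFreeBistratified (φ ⁻¹' s) :=
  ⟨(hs.preimage φ).isFreeStratified, by
    rw [← Set.preimage_compl]; exact (hs'.preimage φ).isFreeStratified⟩

theorem setOfPred_nonneg (φ : G →+ ℤ) : IsFreeBistratified {x | 0 ≤ φ x} :=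
  preimage Int.isFGModuleSet_Ici_zero (by simpa using Int.isFGModuleSet_Iio_zero) φ

theorem setOfPred_eq_zero (φ : G →+ ℤ) : IsFreeBistratified {x | φ x = 0} := by
  convert (setOfPred_nonneg φ).inter (setOfPred_nonneg (-φ)) using 1
  ext x
  simp [le_antisymm_iff, and_comm]

theorem setOfPred_dvd {m : ℤ} (hm : 0 < m) (φ : G →+ ℤ) : IsFreeBistratified {x | m ∣ φ x} := by
  convert preimage (Int.isFGModuleSet_setOfPred_emod_mem hm {0})
    (Int.isFGModuleSet_setOfPred_emod_mem hm {0}ᶜ) φ using 1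
  ext x
  exact Int.dvd_iff_emod_eq_zero

end IsFreeBistratified

theorem sum_natCast_zsmul_single [AddCommGroup G] {ι : Type*} [Fintype ι] [DecidableEq ι]
    (g : (ι → ℕ) →+ G) (u : ι → ℕ) : g u = ∑ i, (u i : ℤ) • g (Pi.single i 1) := by
  conv_lhs => rw [← Finset.univ_sum_single u]
  rw [map_sum]
  refine Finset.sum_congr rfl fun i _ => ?_
  rw [natCast_zsmul, ← map_nsmul, ← Pi.single_smul, nsmul_one, Nat.cast_id]

/-- Up to a positive multiple, the coordinates with respect to an independent family of integer
vectors extend to integer linear forms. -/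
theorem exists_addMonoidHom_of_injective {d : ℕ} {ι : Type*} [Finite ι]
    {g : (ι → ℕ) →+ (Fin d → ℤ)} (hg : Function.Injective g) :
    ∃ m : ℤ, 0 < m ∧ ∃ φ : (Fin d → ℤ) →+ (ι → ℤ), ∀ u i, φ (g u) i = m * u i := by
  classical
  have := Fintype.ofFinite ι
  let b (i : ι) : Fin d → ℤ := g (Pi.single i 1)
  have hgb : ∀ u, g u = ∑ i, (u i : ℤ) • b i := sum_natCast_zsmul_single g
  have hb : LinearIndependent ℤ b := by
    rw [Fintype.linearIndependent_iff]
    intro z hz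
    have h : g (fun i => (z i).toNat) = g (fun i => (-z i).toNat) := by
      rw [hgb, hgb, ← sub_eq_zero, ← Finset.sum_sub_distrib, ← hz]
      refine Finset.sum_congr rfl fun i _ => ?_
      rw [← sub_smul, Int.toNat_sub_toNat_neg]
    intro i
    have := congrFun (hg h) i
    omega
  let ρ : (Fin d → ℤ) →ₗ[ℤ] (Fin d → ℚ) := (Algebra.linearMap ℤ ℚ).compLeft (Fin d)
  have hρ : Function.Injective ρ := fun x y h => by
    ext k
    have := congrFun h k
    simpa [ρ] using this
  have hb' : LinearIndependent ℚ (ρ ∘ b) := by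
    rw [← LinearIndependent.iff_fractionRing ℤ ℚ]
    exact hb.map' ρ (LinearMap.ker_eq_bot.2 hρ)
  obtain ⟨Ψ, hΨ⟩ := LinearMap.exists_leftInverse_of_injective
    (Fintype.linearCombination ℚ (ρ ∘ b)) (LinearMap.ker_eq_bot.2
      (linearIndependent_iff_injective_fintypeLinearCombination.1 hb'))
  have hΨb : ∀ i, Ψ (ρ (b i)) = Pi.single i 1 := fun i => by
    simpa using LinearMap.congr_fun hΨ (Pi.single i 1)
  obtain ⟨⟨m, hm⟩, hint⟩ := IsLocalization.exist_integer_multiples_of_finite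
    (nonZeroDivisors ℤ) (fun p : Fin d × ι => Ψ (ρ (Pi.single p.1 1)) p.2)
  choose c hc using hint
  have key : ∀ x i, ((∑ k, x k * c (k, i) : ℤ) : ℚ) = m * Ψ (ρ x) i := by
    intro x i
    have hx : x = ∑ k, x k • (Pi.single k 1 : Fin d → ℤ) := by
      ext k
      simp [Pi.single_apply]
    conv_rhs => rw [hx]
    simp only [map_sum, map_zsmul, Finset.sum_apply, Finset.mul_sum, Int.cast_sum, Int.cast_mul]
    refine Finset.sum_congr rfl fun k _ => ?_
    have := hc (k, i)
    simp only [eq_intCast] at this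
    rw [this]
    simp
    ring
  have hm0 : m ≠ 0 := nonZeroDivisors.ne_zero hm
  refine ⟨m * m, mul_self_pos.2 hm0, AddMonoidHom.mk' (fun x i => m * ∑ k, x k * c (k, i)) ?_, ?_⟩
  · intro x y
    ext i
    simp [add_mul, Finset.sum_add_distrib, mul_add]
  · intro u i
    have h : Ψ (ρ (g u)) i = u i := by
      rw [hgb]
      simp only [map_sum, map_zsmul, hΨb]
      simp [Pi.single_apply]
    have := key (g u) i
    rw [h] at this
    simp only [AddMonoidHom.mk'_apply, mul_assoc]
    congr 1
    exact_mod_cast this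

theorem IsFreeTranslate.isFreeBistratified {d : ℕ} {s : Set (Fin d → ℤ)} (hs : IsFreeTranslate s) :
    IsFreeBistratified s := by
  classical
  obtain ⟨ι, _, a, g, hg, rfl⟩ := hs
  refine .vadd ?_ a
  have := Fintype.ofFinite ι
  obtain ⟨m, hm, φ, hφ⟩ := exists_addMonoidHom_of_injective hg
  let b (i : ι) : Fin d → ℤ := g (Pi.single i 1)
  have hgb : ∀ u, g u = ∑ i, (u i : ℤ) • b i := sum_natCast_zsmul_single g
  let ψ (i : ι) : (Fin d → ℤ) →+ ℤ := (Pi.evalAddMonoidHom _ i).comp φ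
  let δ (j : Fin d) : (Fin d → ℤ) →+ ℤ :=
    AddMonoidHom.mk' (fun x => m * x j - ∑ i, φ x i * b i j) fun x y => by
      simp only [map_add, Pi.add_apply, add_mul, mul_add, Finset.sum_add_distrib]
      abel
  have hrange : Set.range g = (⋂ j, {x | δ j x = 0}) ∩
      ⋂ i, ({x | m ∣ ψ i x} ∩ {x | 0 ≤ ψ i x}) := by
    ext x
    simp only [Set.mem_inter_iff, Set.mem_iInter, Set.mem_ofPred_eq]
    constructor
    · rintro ⟨u, rfl⟩
      refine ⟨fun j => ?_, fun i => ?_⟩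
      · simp only [δ, AddMonoidHom.mk'_apply, hφ]
        simp [congrFun (hgb u) j, Finset.mul_sum, mul_assoc]
      · simp only [ψ, AddMonoidHom.comp_apply, Pi.evalAddMonoidHom_apply, hφ]
        exact ⟨dvd_mul_right _ _, by positivity⟩
    · rintro ⟨hδ, hψ⟩
      choose z hz using fun i => (hψ i).1
      have hz0 : ∀ i, 0 ≤ z i := fun i => by
        have := (hψ i).2
        rw [hz] at this
        exact nonneg_of_mul_nonneg_right this hm
      refine ⟨fun i => (z i).toNat, ?_⟩
      ext j
      apply mul_left_cancel₀ hm.ne'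
      rw [sub_eq_zero.1 (hδ j), hgb]
      simp only [Finset.sum_apply, Pi.smul_apply, smul_eq_mul, Finset.mul_sum, ← mul_assoc]
      refine Finset.sum_congr rfl fun i _ => ?_
      rw [Int.toNat_of_nonneg (hz0 i), ← hz i]
      rfl
  rw [hrange]
  exact (IsFreeBistratified.iInter fun j => .setOfPred_eq_zero _).inter
    (.iInter fun i => (IsFreeBistratified.setOfPred_dvd hm _).inter (.setOfPred_nonneg _))

theorem IsFreeStratified.iUnion_isFGModuleSet {d : ℕ} {κ : Type*} [Finite κ]
    {s : κ → Set (Fin d → ℤ)} (hs : ∀ k, IsFGModuleSet (s k)) :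
    IsFreeStratified (⋃ k, s k) := by
  refine (IsFreeBistratified.iUnion fun k => ?_).1
  obtain ⟨κ', _, T, hT, -, hU⟩ := (hs k).isFreeStratified
  rw [hU]
  exact .iUnion fun k' => (hT k').isFreeBistratified

theorem isNormalAffineSemigroup_mrange {d : ℕ} {ι : Type*} [Finite ι]
    {g : (ι → ℕ) →+ (Fin d → ℤ)} (hg : Function.Injective g) :
    IsNormalAffineSemigroup (AddMonoidHom.mrange g) := by
  refine ⟨?_, fun n x hn hx hnx => ?_⟩
  · rw [AddMonoidHom.mrange_eq_map]
    exact AddMonoid.FG.fg_top.map g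
  have hdiff : ∃ u v, x = g u - g v := by
    clear hnx
    induction hx using AddSubgroup.closure_induction with
    | mem x hx =>
      obtain ⟨u, rfl⟩ := hx
      exact ⟨u, 0, by simp⟩
    | zero => exact ⟨0, 0, by simp⟩
    | add x y _ _ hx hy =>
      obtain ⟨u, v, rfl⟩ := hx
      obtain ⟨u', v', rfl⟩ := hy
      exact ⟨u + u', v + v', by simp only [map_add]; abel⟩
    | neg x _ hx =>
      obtain ⟨u, v, rfl⟩ := hx
      exact ⟨v, u, by abel⟩
  obtain ⟨u, v, rfl⟩ := hdiff
  obtain ⟨w, hw⟩ := hnx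
  have hle : v ≤ u := fun i => by
    have h : w + n • v = n • u := hg (by rw [map_add, map_nsmul, map_nsmul, hw, smul_sub]; abel)
    have := congrFun h i
    simp only [Pi.add_apply, Pi.smul_apply, smul_eq_mul] at this
    exact Nat.le_of_mul_le_mul_left (by omega) hn
  obtain ⟨y, rfl⟩ := exists_add_of_le hle
  exact ⟨y, by simp⟩

theorem IsFreeTranslate.exists_isNormalAffineSemigroup {d : ℕ} {s : Set (Fin d → ℤ)}
    (hs : IsFreeTranslate s) : ∃ (f : Fin d → ℤ) (A : AddSubmonoid (Fin d → ℤ)),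
      IsNormalAffineSemigroup A ∧ s = {f} + (A : Set (Fin d → ℤ)) := by
  obtain ⟨ι, _, a, g, hg, rfl⟩ := hs
  exact ⟨a, _, isNormalAffineSemigroup_mrange hg, by
    rw [Set.singleton_add, AddMonoidHom.coe_mrange]; rfl⟩

end

/-- The six equivalent characterizations of possessing an affine stratification. -/
theorem isAffineStratification_tfae {d : ℕ} (W : Set (Fin d → ℤ)) :
    List.TFAE
      [ -- (1) W possesses an affine stratification
        IsAffineStratification W,
        -- (2) W is a finite union of finitely generated modules over affine semigroups
        ∃ (r : ℕ) (F : Fin r → Finset (Fin d → ℤ)) (A : Fin r → AddSubmonoid (Fin d → ℤ)),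
          (∀ i, (A i).FG) ∧
          W = ⋃ i, ((F i : Set (Fin d → ℤ)) + (A i : Set (Fin d → ℤ))),
        -- (3) W is a finite union of translates of affine semigroups
        ∃ (r : ℕ) (f : Fin r → (Fin d → ℤ)) (A : Fin r → AddSubmonoid (Fin d → ℤ)),
          (∀ i, (A i).FG) ∧
          W = ⋃ i, (({f i} : Set (Fin d → ℤ)) + (A i : Set (Fin d → ℤ))),
        -- (4) W is a finite union of translates of normal affine semigroups
        ∃ (r : ℕ) (f : Fin r → (Fin d → ℤ)) (A : Fin r → AddSubmonoid (Fin d → ℤ)),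
          (∀ i, IsNormalAffineSemigroup (A i)) ∧
          W = ⋃ i, (({f i} : Set (Fin d → ℤ)) + (A i : Set (Fin d → ℤ))),
        -- (5) W is a finite disjoint union of translates of normal affine semigroups
        ∃ (r : ℕ) (f : Fin r → (Fin d → ℤ)) (A : Fin r → AddSubmonoid (Fin d → ℤ)),
          (∀ i, IsNormalAffineSemigroup (A i)) ∧
          (Pairwise fun i j => Disjoint
            (({f i} : Set (Fin d → ℤ)) + (A i : Set (Fin d → ℤ)))
            (({f j} : Set (Fin d → ℤ)) + (A j : Set (Fin d → ℤ)))) ∧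
          W = ⋃ i, (({f i} : Set (Fin d → ℤ)) + (A i : Set (Fin d → ℤ))),
        -- (6) W is a finite disjoint union of translates of affine semigroups
        ∃ (r : ℕ) (f : Fin r → (Fin d → ℤ)) (A : Fin r → AddSubmonoid (Fin d → ℤ)),
          (∀ i, (A i).FG) ∧
          (Pairwise fun i j => Disjoint
            (({f i} : Set (Fin d → ℤ)) + (A i : Set (Fin d → ℤ)))
            (({f j} : Set (Fin d → ℤ)) + (A j : Set (Fin d → ℤ)))) ∧
          W = ⋃ i, (({f i} : Set (Fin d → ℤ)) + (A i : Set (Fin d → ℤ))) ] := by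
  tfae_have 1 → 2 := fun ⟨r, F, A, hA, _, hW⟩ => ⟨r, F, A, hA, hW⟩
  tfae_have 2 → 5 := by
    rintro ⟨r, F, A, hA, rfl⟩
    obtain ⟨κ, _, T, hT, hd, hU⟩ := IsFreeStratified.iUnion_isFGModuleSet
      fun i => (⟨_, A i, (F i).finite_toSet, hA i, rfl⟩ :
        IsFGModuleSet ((F i : Set (Fin d → ℤ)) + (A i : Set (Fin d → ℤ))))
    choose f B hB hf using fun k => (hT k).exists_isNormalAffineSemigroup
    obtain ⟨n, ⟨e⟩⟩ := Finite.exists_equiv_fin κ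
    refine ⟨n, f ∘ e.symm, B ∘ e.symm, fun i => hB _, fun i j hij => ?_, ?_⟩
    · simp only [Function.comp_apply, ← hf]
      exact hd (e.symm.injective.ne hij)
    · simp only [hU, Function.comp_apply, ← hf]
      exact (e.symm.iSup_comp (g := T)).symm
  tfae_have 5 → 4 := fun ⟨r, f, A, hA, _, hW⟩ => ⟨r, f, A, hA, hW⟩
  tfae_have 4 → 3 := fun ⟨r, f, A, hA, hW⟩ => ⟨r, f, A, fun i => (hA i).1, hW⟩
  tfae_have 3 → 2 := fun ⟨r, f, A, hA, hW⟩ => ⟨r, fun i => {f i}, A, hA, by simpa using hW⟩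
  tfae_have 5 → 6 := fun ⟨r, f, A, hA, hd, hW⟩ => ⟨r, f, A, fun i => (hA i).1, hd, hW⟩
  tfae_have 6 → 1 := fun ⟨r, f, A, hA, hd, hW⟩ =>
    ⟨r, fun i => {f i}, A, hA, by simpa using hd, by simpa using hW⟩
  tfae_finish
end

section
/- If a set W ⊆ ℤ^d is a finite (not necessarily disjoint) union of translates fᵢ + Aᵢ of normal affine semigroups Aᵢ ⊆ ℤ^d, then W can be written as a finite disjoint union of translates gⱼ + Bⱼ of normal affine semigroups Bⱼ ⊆ ℤ^d. -/
open Pointwise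

/-- Integral dual functionals, up to a common positive factor, of a linearly independent family. -/
lemma exists_addMonoidHom_apply_eq_ite {d : ℕ} {κ : Type*} [Fintype κ] [DecidableEq κ]
    {v : κ → Fin d → ℤ} (hv : LinearIndependent ℕ v) :
    ∃ (N : ℕ) (φ : κ → (Fin d → ℤ) →+ ℤ), N ≠ 0 ∧
      ∀ j k, φ j (v k) = if j = k then (N : ℤ) else 0 := by
  have hv' : ∀ c : κ → ℤ, ∑ k, c k • v k = 0 → c = 0 := by
    intro c hc
    have key := Fintype.linearIndependent_iffₛ.1 hv (fun k => (c k).toNat)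
      (fun k => (-c k).toNat) ?_
    · ext k
      have := key k
      simp only [Pi.zero_apply]
      omega
    · rw [← sub_eq_zero, ← Finset.sum_sub_distrib, ← hc]
      refine Finset.sum_congr rfl fun k _ => ?_
      rw [← natCast_zsmul, ← natCast_zsmul, ← sub_smul]
      congr 1
      omega
  let V : Matrix (Fin d) κ ℤ := Matrix.of fun i k => v k i
  have hVc : ∀ c, V.mulVec c = ∑ k, c k • v k := by
    intro c
    ext i
    simp [V, Matrix.mulVec, dotProduct, mul_comm]
  have hdet : (V.transpose * V).det ≠ 0 := by
    intro h0
    obtain ⟨c, hc, hc0⟩ := Matrix.exists_mulVec_eq_zero_iff.2 h0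
    refine hc (hv' c ?_)
    rw [← hVc, ← dotProduct_self_eq_zero]
    rw [← Matrix.mulVec_mulVec, Matrix.mulVec_transpose] at hc0
    rw [Matrix.dotProduct_mulVec, hc0, zero_dotProduct]
  set D := (V.transpose * V).det
  let M : Matrix κ (Fin d) ℤ := D • ((V.transpose * V).adjugate * V.transpose)
  refine ⟨(D * D).natAbs, fun j => ((LinearMap.proj j).comp M.mulVecLin).toAddMonoidHom,
    by simpa using hdet, fun j k => ?_⟩
  have h : M * V = (D * D) • (1 : Matrix κ κ ℤ) := by
    simp only [M, Matrix.smul_mul, Matrix.mul_assoc, Matrix.adjugate_mul, smul_smul, D]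
  have h2 := congrFun (congrFun h j) k
  rw [Int.natAbs_of_nonneg (mul_self_nonneg D)]
  simp only [Matrix.smul_apply, Matrix.one_apply, smul_eq_mul, mul_ite, mul_one, mul_zero] at h2
  rw [← h2]
  rfl

/-- A submonoid of `ℤ^d` cut out of a subgroup by finitely many homogeneous linear inequalities
is a normal affine semigroup. -/
lemma isNormalAffineSemigroup_of_mem_iff {d : ℕ} {ι : Type*} {H : AddSubgroup (Fin d → ℤ)}
    {φ : ι → (Fin d → ℤ) →+ ℤ} {J : Finset ι} {A : AddSubmonoid (Fin d → ℤ)}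
    (hA : ∀ x, x ∈ A ↔ x ∈ H ∧ ∀ j ∈ J, 0 ≤ φ j x) : IsNormalAffineSemigroup A := by
  constructor
  · have hH : H.toAddSubmonoid.FG := by
      rw [← AddSubgroup.fg_iff_addSubmonoid_fg]
      have : (AddSubgroup.toIntSubmodule H).FG := IsNoetherian.noetherian _
      simpa [Submodule.fg_iff_addSubgroup_fg] using this
    obtain ⟨n, g, hg⟩ := AddSubmonoid.fg_iff_exists_fin_addMonoidHom.1 hH
    let f₁ : (Fin n → ℕ) × (J → ℕ) →+ (J → ℤ) :=
      (AddMonoidHom.mk' (fun x (j : J) => φ j x) (by intros; ext; simp)).comp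
        (g.comp (AddMonoidHom.fst _ _))
    let f₂ : (Fin n → ℕ) × (J → ℕ) →+ (J → ℤ) :=
      ((Nat.castAddMonoidHom ℤ).compLeft J).comp (AddMonoidHom.snd _ _)
    convert! (AddSubmonoid.fg_eqLocusM f₁ f₂).map (g.comp (AddMonoidHom.fst _ _))
    ext x
    rw [hA, AddSubmonoid.mem_map, ← AddSubgroup.mem_toAddSubmonoid, ← hg]
    constructor
    · rintro ⟨⟨u, rfl⟩, hx⟩
      refine ⟨(u, fun j => (φ j (g u)).toNat), ?_, rfl⟩
      ext j
      simpa [f₁, f₂] using hx j j.2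
    · rintro ⟨⟨u, s⟩, hus, rfl⟩
      refine ⟨⟨u, rfl⟩, fun j hj => ?_⟩
      have := congrFun hus ⟨j, hj⟩
      simp only [f₁, f₂, AddMonoidHom.comp_apply, AddMonoidHom.mk'_apply,
        AddMonoidHom.compLeft_apply, Function.comp_apply] at this
      rw [AddMonoidHom.comp_apply, this]
      simp
  · intro n x hn hx hnx
    have hAH : AddSubgroup.closure (A : Set (Fin d → ℤ)) ≤ H :=
      (AddSubgroup.closure_le _).2 fun y hy => ((hA y).1 hy).1
    refine (hA x).2 ⟨hAH hx, fun j hj => ?_⟩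
    have := ((hA _).1 hnx).2 j hj
    rw [map_nsmul, nsmul_eq_mul] at this
    exact nonneg_of_mul_nonneg_right this (by exact_mod_cast hn)

/-- A translate of a normal affine semigroup. -/
def IsNormalTranslate {d : ℕ} (s : Set (Fin d → ℤ)) : Prop :=
  ∃ (g : Fin d → ℤ) (B : AddSubmonoid (Fin d → ℤ)), IsNormalAffineSemigroup B ∧
    s = {g} + (B : Set (Fin d → ℤ))

/-- A finite disjoint union of translates of normal affine semigroups. -/
def IsDisjointUnionOfNormal {d : ℕ} (s : Set (Fin d → ℤ)) : Prop :=
  ∃ (ι : Type) (_ : Finite ι) (t : ι → Set (Fin d → ℤ)), (∀ i, IsNormalTranslate (t i)) ∧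
    Pairwise (Function.onFun Disjoint t) ∧ s = ⋃ i, t i

namespace IsDisjointUnionOfNormal

variable {d : ℕ} {s : Set (Fin d → ℤ)}

lemma empty : IsDisjointUnionOfNormal (∅ : Set (Fin d → ℤ)) :=
  ⟨Empty, inferInstance, Empty.elim, nofun, nofun, by simp⟩

lemma of_isNormalTranslate (hs : IsNormalTranslate s) : IsDisjointUnionOfNormal s :=
  ⟨Unit, inferInstance, fun _ => s, fun _ => hs, fun _ _ h => (h rfl).elim,
    (Set.iUnion_const s).symm⟩

lemma of_fibers {κ : Type} (F : (Fin d → ℤ) → κ) (hF : (F '' s).Finite)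
    (h : ∀ k, IsDisjointUnionOfNormal (s ∩ F ⁻¹' {k})) : IsDisjointUnionOfNormal s := by
  choose ι hι t ht htd hst using h
  have := hF.to_subtype
  refine ⟨Σ k : F '' s, ι k, inferInstance, fun i => t i.1 i.2, fun i => ht _ _, ?_, ?_⟩
  · rintro ⟨k, i⟩ ⟨l, j⟩ hij
    by_cases hkl : k = l
    · subst hkl
      exact htd _ fun h => hij (congrArg (Sigma.mk k) h)
    · have hsub : ∀ k i, t k i ⊆ F ⁻¹' {k} := fun k i =>
        (Set.subset_iUnion (t k) i).trans ((hst k).symm.subset.trans Set.inter_subset_right)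
      refine Disjoint.mono (hsub _ _) (hsub _ _) ?_
      refine Disjoint.preimage _ ?_
      simpa [Subtype.ext_iff] using hkl
  · ext x
    rw [Set.iUnion_sigma]
    simp only [← hst, Set.mem_iUnion]
    constructor
    · exact fun hx => ⟨⟨F x, x, hx, rfl⟩, hx, rfl⟩
    · exact fun ⟨_, hx, _⟩ => hx

lemma setOf_mem_and_le {ι : Type} (φ : ι → (Fin d → ℤ) →+ ℤ) (J : Finset ι) (c : ι → ℤ)
    (H : AddSubgroup (Fin d → ℤ)) (p : Fin d → ℤ) :
    IsDisjointUnionOfNormal {x | x - p ∈ H ∧ ∀ j ∈ J, c j ≤ φ j x} := by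
  induction J using Finset.strongInduction generalizing c H p with | _ J ih
  obtain h0 | ⟨q, hq⟩ := Set.eq_empty_or_nonempty {x | x - p ∈ H ∧ ∀ j ∈ J, c j ≤ φ j x}
  · rw [h0]
    exact empty
  refine of_fibers (fun x (j : J) => min (φ j x - φ j q) 0) ?_ fun v => ?_
  · refine (Set.Finite.pi fun j : J => Set.finite_Icc (c j - φ j q) 0).subset ?_
    rintro _ ⟨x, hx, rfl⟩ j -
    refine ⟨?_, min_le_right _ _⟩
    have h1 := hx.2 j j.2
    have h2 := hq.2 j j.2
    exact le_min (by linarith) (by linarith)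
  by_cases hv : v = 0
  · subst hv
    let A : AddSubmonoid (Fin d → ℤ) :=
      { carrier := {x | x ∈ H ∧ ∀ j ∈ J, 0 ≤ φ j x}
        zero_mem' := ⟨H.zero_mem, by simp⟩
        add_mem' := fun {x y} hx hy => ⟨H.add_mem hx.1 hy.1, fun j hj => by
          rw [map_add]
          exact add_nonneg (hx.2 j hj) (hy.2 j hj)⟩ }
    refine of_isNormalTranslate ⟨q, A, isNormalAffineSemigroup_of_mem_iff fun x => Iff.rfl, ?_⟩
    ext x
    rw [Set.singleton_add, Set.mem_image]
    constructor
    · rintro ⟨⟨hx1, -⟩, hx3⟩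
      refine ⟨x - q, ⟨?_, fun j hj => ?_⟩, by abel⟩
      · simpa using H.sub_mem hx1 hq.1
      · have := congrFun hx3 ⟨j, hj⟩
        simpa using this
    · rintro ⟨y, ⟨hy1, hy2⟩, rfl⟩
      refine ⟨⟨?_, fun j hj => ?_⟩, ?_⟩
      · simpa [add_sub_right_comm] using H.add_mem hq.1 hy1
      · rw [map_add]
        have := hq.2 j hj
        have := hy2 j hj
        omega
      · ext j
        simpa using hy2 j j.2
  obtain h1 | ⟨y, hy, rfl⟩ := Set.eq_empty_or_nonempty ({x | x - p ∈ H ∧ ∀ j ∈ J, c j ≤ φ j x} ∩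
    (fun x (j : J) => min (φ j x - φ j q) 0) ⁻¹' {v})
  · rw [h1]
    exact empty
  convert! ih (J.filter fun j => φ j q ≤ φ j y) ?_ (fun j => φ j q)
    (H ⊓ ⨅ j ∈ J.filter fun j => ¬ φ j q ≤ φ j y, (φ j).ker) y using 1
  · ext x
    simp only [Set.mem_inter_iff, Set.mem_ofPred_eq, Set.mem_preimage, Set.mem_singleton_iff,
      AddSubgroup.mem_inf, AddSubgroup.mem_iInf, Finset.mem_filter, AddMonoidHom.mem_ker, map_sub,
      funext_iff, Subtype.forall]
    constructor
    · rintro ⟨⟨hx1, hx2⟩, hx3⟩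
      refine ⟨⟨by simpa using H.sub_mem hx1 hy.1, fun j hj => ?_⟩, fun j hj => ?_⟩
      · have := hx3 j hj.1
        omega
      · have := hx3 j hj.1
        omega
    · rintro ⟨⟨hx1, hx2⟩, hx3⟩
      refine ⟨⟨by simpa using H.add_mem hx1 hy.1, fun j hj => ?_⟩, fun j hj => ?_⟩
      all_goals
        have h2 := hx2 j
        have h3 := hx3 j
        have := hy.2 j hj
        have := hq.2 j hj
        simp only [hj, true_and] at h2 h3
        by_cases h : φ j q ≤ φ j y
        · have := h3 h
          omega
        · have := h2 h
          omega
  · rw [Finset.filter_ssubset]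
    by_contra! hcon
    refine hv ?_
    ext j
    simpa using hcon j j.2

end IsDisjointUnionOfNormal

/-- Empty, or an intersection of a coset with finitely many halfspaces. -/
def IsLatticePolyhedron {d : ℕ} (s : Set (Fin d → ℤ)) : Prop :=
  ∃ (H : AddSubgroup (Fin d → ℤ)) (J : Finset (((Fin d → ℤ) →+ ℤ) × ℤ)),
    ∀ p ∈ s, ∀ x, x ∈ s ↔ x - p ∈ H ∧ ∀ j ∈ J, j.2 ≤ j.1 x

lemma IsLatticePolyhedron.iInter {d : ℕ} {ι : Type*} [Finite ι] {s : ι → Set (Fin d → ℤ)}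
    (hs : ∀ i, IsLatticePolyhedron (s i)) : IsLatticePolyhedron (⋂ i, s i) := by
  classical
  have := Fintype.ofFinite ι
  choose H J h using hs
  refine ⟨⨅ i, H i, Finset.univ.biUnion J, fun p hp x => ?_⟩
  rw [Set.mem_iInter] at hp ⊢
  simp only [fun i => h i p (hp i) x, AddSubgroup.mem_iInf, Finset.mem_biUnion, Finset.mem_univ,
    true_and, forall_exists_index, forall_and]
  grind

lemma IsLatticePolyhedron.isDisjointUnionOfNormal {d : ℕ} {s : Set (Fin d → ℤ)}
    (hs : IsLatticePolyhedron s) : IsDisjointUnionOfNormal s := by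
  obtain rfl | ⟨p, hp⟩ := s.eq_empty_or_nonempty
  · exact .empty
  obtain ⟨H, J, h⟩ := hs
  convert! IsDisjointUnionOfNormal.setOf_mem_and_le Prod.fst J Prod.snd H p
  ext x
  exact h p hp x

/-- A union of cells of a finite partition into lattice polyhedra. -/
def IsUnionOfPolyhedralCells {d : ℕ} (s : Set (Fin d → ℤ)) : Prop :=
  ∃ (κ : Type) (_ : Finite κ) (F : (Fin d → ℤ) → κ),
    (∀ k, IsLatticePolyhedron (F ⁻¹' {k})) ∧ ∀ x y, F x = F y → x ∈ s → y ∈ s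

namespace IsUnionOfPolyhedralCells

variable {d : ℕ}

lemma isDisjointUnionOfNormal {s : Set (Fin d → ℤ)} (hs : IsUnionOfPolyhedralCells s) :
    IsDisjointUnionOfNormal s := by
  obtain ⟨κ, hκ, F, hF, h⟩ := hs
  refine .of_fibers F (Set.toFinite _) fun k => ?_
  obtain h0 | ⟨x, hx, rfl⟩ := (s ∩ F ⁻¹' {k}).eq_empty_or_nonempty
  · rw [h0]
    exact .empty
  · rw [Set.inter_eq_right.2 (show F ⁻¹' {F x} ⊆ s from fun y hy => h x y (Eq.symm hy) hx)]
    exact (hF _).isDisjointUnionOfNormal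

lemma exists_common {ι : Type} [Finite ι] {s : ι → Set (Fin d → ℤ)}
    (hs : ∀ i, IsUnionOfPolyhedralCells (s i)) :
    ∃ (κ : Type) (_ : Finite κ) (F : (Fin d → ℤ) → κ),
      (∀ k, IsLatticePolyhedron (F ⁻¹' {k})) ∧ ∀ i x y, F x = F y → x ∈ s i → y ∈ s i := by
  choose κ hκ F hF h using hs
  refine ⟨∀ i, κ i, inferInstance, fun x i => F i x, fun k => ?_,
    fun i x y hxy => h i x y (congrFun hxy i)⟩
  convert! IsLatticePolyhedron.iInter fun i => hF i (k i)
  ext x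
  simp [funext_iff]

lemma iUnion {ι : Type} [Finite ι] {s : ι → Set (Fin d → ℤ)}
    (hs : ∀ i, IsUnionOfPolyhedralCells (s i)) : IsUnionOfPolyhedralCells (⋃ i, s i) := by
  obtain ⟨κ, hκ, F, hF, h⟩ := exists_common hs
  refine ⟨κ, hκ, F, hF, fun x y hxy hx => ?_⟩
  rw [Set.mem_iUnion] at hx ⊢
  exact hx.imp fun i => h i x y hxy

lemma iInter {ι : Type} [Finite ι] {s : ι → Set (Fin d → ℤ)}
    (hs : ∀ i, IsUnionOfPolyhedralCells (s i)) : IsUnionOfPolyhedralCells (⋂ i, s i) := by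
  obtain ⟨κ, hκ, F, hF, h⟩ := exists_common hs
  refine ⟨κ, hκ, F, hF, fun x y hxy hx => ?_⟩
  rw [Set.mem_iInter] at hx ⊢
  exact fun i => h i x y hxy (hx i)

lemma inter {s t : Set (Fin d → ℤ)} (hs : IsUnionOfPolyhedralCells s)
    (ht : IsUnionOfPolyhedralCells t) : IsUnionOfPolyhedralCells (s ∩ t) := by
  rw [Set.inter_eq_iInter]
  exact iInter (Bool.forall_bool.2 ⟨ht, hs⟩)

lemma setOf_le (φ : (Fin d → ℤ) →+ ℤ) (c : ℤ) : IsUnionOfPolyhedralCells {x | c ≤ φ x} := by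
  refine ⟨Prop, inferInstance, fun x => c ≤ φ x, fun k => ?_, fun x y hxy hx => ?_⟩
  · by_cases hk : k
    · refine ⟨⊤, {(φ, c)}, fun p _ x => ?_⟩
      simp [hk]
    · refine ⟨⊤, {(-φ, 1 - c)}, fun p _ x => ?_⟩
      simp only [Set.mem_preimage, Set.mem_singleton_iff, eq_iff_iff, hk, iff_false,
        AddSubgroup.mem_top, true_and, Finset.mem_singleton, forall_eq, AddMonoidHom.neg_apply]
      omega
  · exact (show (c ≤ φ x) = (c ≤ φ y) from hxy).mp hx

lemma setOf_eq (φ : (Fin d → ℤ) →+ ℤ) (c : ℤ) : IsUnionOfPolyhedralCells {x | φ x = c} := by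
  convert! (setOf_le φ c).inter (setOf_le (-φ) (-c))
  ext x
  simp [le_antisymm_iff, and_comm]

lemma setOf_modEq (φ : (Fin d → ℤ) →+ ℤ) {N : ℕ} (hN : N ≠ 0) (c : ℤ) :
    IsUnionOfPolyhedralCells {x | (N : ℤ) ∣ φ x - c} := by
  have : NeZero N := ⟨hN⟩
  refine ⟨ZMod N, inferInstance, fun x => (φ x : ZMod N), fun k => ?_, fun x y hxy hx => ?_⟩
  · refine ⟨((Int.castAddHom (ZMod N)).comp φ).ker, ∅, fun p hp x => ?_⟩
    rw [Set.mem_preimage, Set.mem_singleton_iff] at hp ⊢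
    simp [AddMonoidHom.mem_ker, sub_eq_zero, hp]
  · have h := (ZMod.intCast_eq_intCast_iff_dvd_sub _ _ _).1 hxy
    rw [Set.mem_ofPred_eq] at hx ⊢
    simpa using dvd_add hx h

end IsUnionOfPolyhedralCells

lemma IsProperLinearSet.isUnionOfPolyhedralCells {d : ℕ} {s : Set (Fin d → ℤ)}
    (hs : IsProperLinearSet s) : IsUnionOfPolyhedralCells s := by
  classical
  obtain ⟨a, t, ht, rfl⟩ := isProperLinearSet_iff.1 hs
  obtain ⟨N, φ, hN, hφ⟩ := exists_addMonoidHom_apply_eq_ite (κ := t) ht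
  replace hφ (j k : t) : φ j k.1 = if j = k then (N : ℤ) else 0 := hφ j k
  let ψ (i : Fin d) : (Fin d → ℤ) →+ ℤ := N • Pi.evalAddMonoidHom _ i -
    ∑ k : t, k.1 i • φ k
  have hψ (i x) : ψ i x = N * x i - ∑ k : t, k.1 i * φ k x := by
    simp [ψ]
  have key : (a +ᵥ (AddSubmonoid.closure (t : Set (Fin d → ℤ)) : Set (Fin d → ℤ))) =
      ((⋂ k, {x | (N : ℤ) ∣ φ k x - φ k a}) ∩ ⋂ k, {x | φ k a ≤ φ k x}) ∩
        ⋂ i, {x | ψ i x = ψ i a} := by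
    ext x
    obtain ⟨y, rfl⟩ : ∃ y, x = a + y := ⟨x - a, by abel⟩
    simp only [Set.mem_inter_iff, Set.mem_iInter, Set.mem_ofPred_eq, map_add, add_sub_cancel_left,
      le_add_iff_nonneg_right, add_eq_left, Set.mem_vadd_set, vadd_eq_add, add_right_inj,
      exists_eq_right, SetLike.mem_coe]
    constructor
    · intro hy
      rw [AddSubmonoid.mem_closure_finset] at hy
      obtain ⟨g, -, rfl⟩ := hy
      have h (k : t) : φ k (∑ x ∈ t, g x • x) = g k * N := by
        rw [← Finset.sum_coe_sort, map_sum]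
        simp_rw [map_nsmul, hφ]
        simp
      simp only [h, hψ]
      refine ⟨⟨fun k => by simp, fun k => by positivity⟩, fun i => ?_⟩
      rw [← Finset.sum_coe_sort, Finset.sum_apply, Finset.mul_sum, sub_eq_zero]
      refine Finset.sum_congr rfl fun k _ => ?_
      simp
      ring
    · rintro ⟨⟨h1, h2⟩, h3⟩
      choose c hc using h1
      have hy : y = ∑ k : t, (c k).toNat • k.1 := by
        ext i
        have h4 := h3 i
        rw [hψ, sub_eq_zero] at h4
        have hN' : (N : ℤ) ≠ 0 := by exact_mod_cast hN
        refine mul_left_cancel₀ hN' ?_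
        rw [h4, Finset.sum_apply, Finset.mul_sum]
        refine Finset.sum_congr rfl fun k _ => ?_
        have h5 : 0 ≤ c k := by
          have := h2 k
          rw [hc] at this
          exact nonneg_of_mul_nonneg_right this (by positivity)
        simp [hc, h5]
        ring
      rw [hy]
      exact sum_mem fun k _ => nsmul_mem (AddSubmonoid.subset_closure k.2) _
  rw [key]
  exact .inter (.inter (.iInter fun k => .setOf_modEq _ hN _) (.iInter fun k => .setOf_le _ _))
    (.iInter fun i => .setOf_eq _ _)

lemma IsSemilinearSet.isDisjointUnionOfNormal {d : ℕ} {s : Set (Fin d → ℤ)}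
    (hs : IsSemilinearSet s) : IsDisjointUnionOfNormal s := by
  obtain ⟨S, hS, hS', rfl⟩ := hs.isProperSemilinearSet
  have := hS.to_subtype
  obtain ⟨n, ⟨e⟩⟩ := Finite.exists_equiv_fin S
  rw [Set.sUnion_eq_iUnion, ← e.symm.surjective.iUnion_comp]
  exact (IsUnionOfPolyhedralCells.iUnion fun i =>
    (hS' _ (e.symm i).2).isUnionOfPolyhedralCells).isDisjointUnionOfNormal

/-- If `W ⊆ ℤ^d` is a finite (not necessarily disjoint) union of translates of
normal affine semigroups, then `W` is a finite *disjoint* union of translates of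
normal affine semigroups. -/
theorem disjoint_union_of_union_of_normal {d n : ℕ} (W : Set (Fin d → ℤ))
    (f : Fin n → (Fin d → ℤ)) (A : Fin n → AddSubmonoid (Fin d → ℤ))
    (hA : ∀ i, IsNormalAffineSemigroup (A i))
    (hW : W = ⋃ i, (({f i} : Set (Fin d → ℤ)) + (A i : Set (Fin d → ℤ)))) :
    ∃ (r : ℕ) (g : Fin r → (Fin d → ℤ)) (B : Fin r → AddSubmonoid (Fin d → ℤ)),
      (∀ j, IsNormalAffineSemigroup (B j)) ∧
      (Pairwise fun j k => Disjoint
        (({g j} : Set (Fin d → ℤ)) + (B j : Set (Fin d → ℤ)))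
        (({g k} : Set (Fin d → ℤ)) + (B k : Set (Fin d → ℤ)))) ∧
      W = ⋃ j, (({g j} : Set (Fin d → ℤ)) + (B j : Set (Fin d → ℤ))) := by
  have hlin : IsSemilinearSet W := by
    rw [hW]
    refine .iUnion fun i => IsLinearSet.isSemilinearSet ?_
    exact isLinearSet_iff_exists_fg_eq_vadd.2 ⟨f i, A i, (hA i).1, Set.singleton_vadd⟩
  obtain ⟨ι, _, t, ht, htd, rfl⟩ := hlin.isDisjointUnionOfNormal
  obtain ⟨r, ⟨e⟩⟩ := Finite.exists_equiv_fin ι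
  choose g B hB hgB using ht
  refine ⟨r, fun j => g (e.symm j), fun j => B (e.symm j), fun j => hB _, fun j k hjk => ?_, ?_⟩
  · simp only [← hgB]
    exact htd (e.symm.injective.ne hjk)
  · simp only [← hgB]
    exact (e.symm.surjective.iUnion_comp t).symm
end

section
/- Fix a homomorphism of additive groups φ : ℤ^n → ℤ^d. If W ⊆ ℤ^n possesses an affine stratification, then its image φ(W) ⊆ ℤ^d also possesses an affine stratification. -/
open Pointwise

open AddSubmonoid in
/-- **Gordan's lemma**: the preimage of a finitely generated submonoid under a homomorphism from
a finitely generated commutative monoid is finitely generated. -/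
theorem AddSubmonoid.FG.comap_mrange {M N I : Type*} [AddCommMonoid M] [AddMonoid.FG M]
    [AddCancelCommMonoid N] [Finite I] (f : M →+ N) (g : (I → ℕ) →+ N) :
    ((AddMonoidHom.mrange g).comap f).FG := by
  obtain ⟨n, e, he⟩ := fg_iff_exists_fin_addMonoidHom.1 (AddMonoid.FG.fg_top (M := M))
  rw [AddMonoidHom.mrange_eq_top] at he
  have h := (AddSubmonoid.fg_eqLocusM
    ((f.comp e).comp (AddMonoidHom.fst (Fin n → ℕ) (I → ℕ)))
    (g.comp (AddMonoidHom.snd (Fin n → ℕ) (I → ℕ)))).map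
    (e.comp (AddMonoidHom.fst (Fin n → ℕ) (I → ℕ)))
  convert h
  ext x
  constructor
  · rintro ⟨k, hk⟩
    obtain ⟨u, rfl⟩ := he x
    exact ⟨(u, k), hk.symm, rfl⟩
  · rintro ⟨⟨u, k⟩, hk, rfl⟩
    exact ⟨k, hk.symm⟩

/-- The sign and residue modulo `m` of an integer. -/
noncomputable def Int.signResidue (m : ℕ) (z : ℤ) : SignType × ZMod m :=
  (SignType.sign z, (z : ZMod m))

theorem Int.exists_eq_sign_mul_of_signResidue_eq {m : ℕ} {y z : ℤ}
    (h : y.signResidue m = z.signResidue m) (hyz : y.natAbs ≤ z.natAbs) :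
    ∃ k : ℕ, z - y = (SignType.sign y : ℤ) * (m * k) := by
  simp only [Int.signResidue, Prod.mk.injEq, ZMod.intCast_eq_intCast_iff_dvd_sub] at h
  obtain ⟨h₁, q, hq⟩ := h
  rcases lt_trichotomy y 0 with hy | rfl | hy
  · rw [_root_.sign_neg hy, eq_comm, sign_eq_neg_one_iff] at h₁
    rcases Nat.eq_zero_or_pos m with rfl | hm
    · exact ⟨0, by simpa using hq⟩
    have : q ≤ 0 := by
      by_contra! hq0
      have : 0 < (m : ℤ) * q := by positivity
      omega
    refine ⟨q.natAbs, ?_⟩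
    rw [hq, _root_.sign_neg hy, Int.natCast_natAbs, abs_of_nonpos this]
    simp
  · rw [_root_.sign_zero, eq_comm, sign_eq_zero_iff] at h₁
    exact ⟨0, by simp [h₁]⟩
  · rw [_root_.sign_pos hy, eq_comm, sign_eq_one_iff] at h₁
    rcases Nat.eq_zero_or_pos m with rfl | hm
    · exact ⟨0, by simpa using hq⟩
    have : 0 ≤ q := by
      by_contra! hq0
      have : (m : ℤ) * q < 0 := mul_neg_of_pos_of_neg (by positivity) hq0
      omega
    refine ⟨q.natAbs, ?_⟩
    rw [hq, _root_.sign_pos hy, Int.natCast_natAbs, abs_of_nonneg this]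
    simp

theorem Int.signResidue_add_sign_mul (m : ℕ) (y : ℤ) (k : ℕ) :
    (y + (SignType.sign y : ℤ) * (m * k)).signResidue m = y.signResidue m := by
  rw [Int.signResidue, Int.signResidue, Prod.mk.injEq]
  refine ⟨?_, by simp⟩
  rcases lt_trichotomy y 0 with hy | rfl | hy
  · rw [_root_.sign_neg hy, sign_eq_neg_one_iff]
    have : (0 : ℤ) ≤ m * k := by positivity
    simp; omega
  · simp
  · rw [_root_.sign_pos hy, sign_eq_one_iff]
    have : (0 : ℤ) ≤ m * k := by positivity
    simp; omega

/-- The points of a finitely generated abelian group at which finitely many affine integer-valued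
functions have prescribed signs and residues form a finite union of translates of one finitely
generated submonoid. -/
theorem exists_finset_add_fg_eq_setOf_signResidue {M I : Type*} [AddCommGroup M] [AddMonoid.FG M]
    [Finite I] (f : M →+ (I → ℤ)) (c : I → ℤ) (m : I → ℕ) (x₀ : M) :
    ∃ (F : Finset M) (A : AddSubmonoid M), A.FG ∧
      {x | ∀ i, (f x i - c i).signResidue (m i) = (f x₀ i - c i).signResidue (m i)} =
        (F : Set M) + (A : Set M) := by
  classical
  set G : Set M :=
    {x | ∀ i, (f x i - c i).signResidue (m i) = (f x₀ i - c i).signResidue (m i)} with hG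
  let g : (I → ℕ) →+ (I → ℤ) :=
    { toFun k i := (SignType.sign (f x₀ i - c i) : ℤ) * (m i * k i)
      map_zero' := by ext; simp
      map_add' k l := by ext; simp; ring }
  let a : M → I → ℕ := fun x i => (f x i - c i).natAbs
  have hfin : {k | Minimal (· ∈ a '' G) k}.Finite :=
    WellQuasiOrderedLE.finite_of_isAntichain (setOfPred_minimal_antichain _)
  have hsub : {k | Minimal (· ∈ a '' G) k} ⊆ a '' G := fun k hk => hk.prop
  obtain ⟨F, hFG, hFfin, hF⟩ :=
    Set.exists_subset_image_finite_and.1 ⟨_, hsub, hfin, rfl⟩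
  refine ⟨hFfin.toFinset, (AddMonoidHom.mrange g).comap f, .comap_mrange f g, ?_⟩
  rw [Set.Finite.coe_toFinset]
  ext x
  rw [Set.mem_add]
  constructor
  · intro hx
    obtain ⟨k, hk, hmin⟩ :=
      (Set.isPWO_of_wellQuasiOrderedLE (a '' G)).exists_le_minimal ⟨x, hx, rfl⟩
    obtain ⟨y, hy, rfl⟩ : k ∈ a '' F := hF ▸ hmin
    refine ⟨y, hy, x - y, ?_, add_sub_cancel y x⟩
    choose q hq using fun i =>
      Int.exists_eq_sign_mul_of_signResidue_eq ((hFG hy i).trans (hx i).symm) (hk i)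
    refine ⟨q, funext fun i => ?_⟩
    have hs := congrArg Prod.fst (hFG hy i)
    simp only [Int.signResidue] at hs
    have := hq i
    simp only [hs] at this
    change (SignType.sign (f x₀ i - c i) : ℤ) * (m i * q i) = _
    rw [← this, map_sub, Pi.sub_apply]
    ring
  · rintro ⟨y, hy, z, ⟨k, hk⟩, rfl⟩ i
    have hs := congrArg Prod.fst (hFG hy i)
    simp only [Int.signResidue] at hs
    rw [← hFG hy i, ← Int.signResidue_add_sign_mul (m i) (f y i - c i) (k i), hs, map_add, ← hk]
    congr 1
    change f y i + (SignType.sign (f x₀ i - c i) : ℤ) * (m i * k i) - _ = _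
    ring

/-- Membership in a linear set with linearly independent periods in `ℤ^d` is determined by the signs
and residues of finitely many affine integer-valued functions. -/
theorem IsProperLinearSet.exists_signResidue {d : ℕ} {L : Set (Fin d → ℤ)}
    (hL : IsProperLinearSet L) :
    ∃ (I : Type) (_ : Finite I) (f : (Fin d → ℤ) →+ (I → ℤ)) (c : I → ℤ) (m : I → ℕ),
      (∀ i, m i ≠ 0) ∧ ∀ x y,
        (∀ i, (f x i - c i).signResidue (m i) = (f y i - c i).signResidue (m i)) →
          x ∈ L → y ∈ L := by
  classical
  obtain ⟨a, t, -, hind, rfl⟩ := hL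
  let e : (Fin d → ℤ) →+ (Fin d → ℚ) := (Int.castAddHom ℚ).compLeft (Fin d)
  have he : Function.Injective e := fun x y h => funext fun i => by
    simpa [e] using congrFun h i
  have hind' : LinearIndepOn ℚ id (e '' t) := by
    refine LinearIndepOn.id_image ?_
    rw [LinearIndepOn, ← LinearIndependent.iff_fractionRing ℤ ℚ, ← LinearIndepOn,
      linearIndepOn_iff'']
    intro u g hu _ hsum i hi
    rw [linearIndepOn_iff_linearIndepOn_finset] at hind
    have hg := linearIndepOn_finset_iffₛ.1 (hind u hu) (fun j => (g j).toNat)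
      (fun j => (-g j).toNat) ?_ i hi
    · omega
    · apply he
      rw [← sub_eq_zero, ← map_sub, ← Finset.sum_sub_distrib, ← hsum, map_sum]
      refine Finset.sum_congr rfl fun j _ => ?_
      conv_rhs => rw [← (g j).toNat_sub_toNat_neg]
      simp only [sub_smul, map_sub, map_nsmul, natCast_zsmul, id_eq]
  let b := Module.Basis.extend hind'
  have hbval (i) : b i = i := Module.Basis.extend_apply_self hind' i
  have : Finite (hind'.extend (Set.subset_univ _)) := Module.Finite.finite_basis b
  obtain ⟨N, hN⟩ := IsLocalization.exist_integer_multiples_of_finite (nonZeroDivisors ℤ)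
    fun p : hind'.extend (Set.subset_univ _) × Fin d => b.repr (Pi.single p.2 1) p.1
  choose z hz using hN
  have hN0 : (N : ℤ) ≠ 0 := nonZeroDivisors.coe_ne_zero N
  let f : (Fin d → ℤ) →+ (hind'.extend (Set.subset_univ _) → ℤ) :=
    AddMonoidHom.mk' (fun x i => ∑ j, x j * (N * z (i, j))) fun x y => by
      ext i
      simp [add_mul, Finset.sum_add_distrib]
  have hf (x i) : (f x i : ℚ) = (N * N : ℤ) * b.repr (e x) i := by
    have hx : e x = ∑ j, (x j : ℚ) • Pi.single j (1 : ℚ) := by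
      ext k
      simp [e, Finset.sum_apply, Pi.single_apply]
    rw [hx, map_sum, Finsupp.finsetSum_apply, Finset.mul_sum]
    simp only [f, AddMonoidHom.mk'_apply, Int.cast_sum, Int.cast_mul]
    refine Finset.sum_congr rfl fun j _ => ?_
    have := hz (i, j)
    simp only [eq_intCast, zsmul_eq_mul] at this
    rw [this, map_smul, Finsupp.smul_apply, smul_eq_mul]
    ring
  have hclosure (y) : y ∈ AddSubmonoid.closure t ↔
      ∀ i, ∃ k : ℕ, b.repr (e y) i = k ∧ ((i : Fin d → ℚ) ∉ e '' t → k = 0) := by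
    constructor
    · intro hy i
      induction hy using AddSubmonoid.closure_induction with
      | mem y hy =>
        have hey := hind'.subset_extend (Set.subset_univ _) ⟨y, hy, rfl⟩
        refine ⟨if i = ⟨e y, hey⟩ then 1 else 0, ?_, fun hi => if_neg fun h => hi ?_⟩
        · have h : b.repr (e y) = Finsupp.single ⟨e y, hey⟩ 1 := by
            rw [← b.repr_self, hbval]
          rw [h, Finsupp.single_apply]
          simp [eq_comm]
        · exact h ▸ ⟨y, hy, rfl⟩
      | zero => exact ⟨0, by simp⟩
      | add y₁ y₂ _ _ ih₁ ih₂ =>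
        obtain ⟨k₁, hk₁, hk₁'⟩ := ih₁
        obtain ⟨k₂, hk₂, hk₂'⟩ := ih₂
        exact ⟨k₁ + k₂, by simp [hk₁, hk₂], fun hi => by rw [hk₁' hi, hk₂' hi]⟩
    · intro h
      have := Fintype.ofFinite (hind'.extend (Set.subset_univ _))
      have hv (i) : ∃ v ∈ AddSubmonoid.closure t, e v = b.repr (e y) i • b i := by
        obtain ⟨k, hk, hk0⟩ := h i
        by_cases hi : (i : Fin d → ℚ) ∈ e '' t
        · obtain ⟨v, hv, hvi⟩ := hi
          refine ⟨k • v, nsmul_mem (AddSubmonoid.subset_closure hv) k, ?_⟩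
          rw [map_nsmul, hvi, hk, hbval, Nat.cast_smul_eq_nsmul]
        · exact ⟨0, zero_mem _, by simp [hk, hk0 hi]⟩
      choose v hv hev using hv
      have hy : y = ∑ i, v i := he <| by
        rw [map_sum, ← b.sum_repr (e y)]
        exact Finset.sum_congr rfl fun i _ => (hev i).symm
      exact hy ▸ sum_mem fun i _ => hv i
  have hmem (x) : x ∈ a +ᵥ (AddSubmonoid.closure t : Set (Fin d → ℤ)) ↔
      ∀ i, ∃ k : ℕ, f x i - f a i = N * N * k ∧ ((i : Fin d → ℚ) ∉ e '' t → k = 0) := by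
    rw [Set.mem_vadd_set_iff_neg_vadd_mem, SetLike.mem_coe, hclosure]
    refine forall_congr' fun i => exists_congr fun k => and_congr_left fun _ => ?_
    rw [← Pi.sub_apply, ← map_sub, vadd_eq_add, neg_add_eq_sub, ← Int.cast_inj (α := ℚ), hf]
    push_cast
    rw [mul_right_inj' (by exact_mod_cast mul_ne_zero hN0 hN0)]
  refine ⟨_, this, f, f a, fun _ => (N * N : ℤ).natAbs, fun _ => by simp [hN0],
    fun x y hxy hx => (hmem y).2 fun i => ?_⟩
  obtain ⟨k, hk, hk0⟩ := (hmem x).1 hx i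
  have hi := hxy i
  rw [hk] at hi
  have hNN : (0 : ℤ) < N * N := mul_self_pos.2 hN0
  obtain ⟨hsign, hres⟩ := Prod.mk.inj hi
  have hdvd : (N * N : ℤ) ∣ f y i - f a i := by
    have := (ZMod.intCast_eq_intCast_iff_dvd_sub _ _ _).1 hres
    rw [Int.natAbs_dvd] at this
    exact (dvd_sub_left (dvd_mul_right _ _)).1 this
  obtain ⟨q, hq⟩ := hdvd
  rw [hq, sign_mul (N * N : ℤ) k, sign_mul (N * N : ℤ) q, sign_pos hNN, one_mul, one_mul] at hsign
  have hq0 : 0 ≤ q := by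
    rw [← sign_nonneg_iff, ← hsign, sign_nonneg_iff]
    positivity
  refine ⟨q.toNat, by rw [hq, Int.toNat_of_nonneg hq0], fun hi => ?_⟩
  rw [hk0 hi, Nat.cast_zero, sign_zero, eq_comm, sign_eq_zero_iff] at hsign
  rw [hsign, Int.toNat_zero]

/-- **Ito's theorem**: every semilinear set of integer vectors is a finite disjoint union of sets
`F + A` with `F` finite and `A` a finitely generated submonoid. -/
theorem IsSemilinearSet.isAffineStratification {d : ℕ} {S : Set (Fin d → ℤ)}
    (hS : IsSemilinearSet S) : IsAffineStratification S := by
  classical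
  obtain ⟨T, hT, hlin, rfl⟩ := hS.isProperSemilinearSet
  have : Finite T := hT
  choose I hI f c m hm hdet using fun L : T => (hlin L L.2).exists_signResidue
  have (i : Σ L : T, I L) : NeZero (m i.1 i.2) := ⟨hm i.1 i.2⟩
  let F : (Fin d → ℤ) →+ ((Σ L : T, I L) → ℤ) :=
    AddMonoidHom.mk' (fun x i => f i.1 x i.2) fun x y => by ext; simp
  let p : (Fin d → ℤ) → ∀ i : Σ L : T, I L, SignType × ZMod (m i.1 i.2) := fun x i =>
    (F x i - c i.1 i.2).signResidue (m i.1 i.2)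
  have : Finite (p '' ⋃₀ T) := Set.toFinite _
  choose B A hA hBA using fun x => exists_finset_add_fg_eq_setOf_signResidue F
    (fun i => c i.1 i.2) (fun i => m i.1 i.2) x
  choose x hxS hx using fun q : p '' ⋃₀ T => q.2
  have hmem (q : p '' ⋃₀ T) (y) :
      y ∈ (B (x q) : Set (Fin d → ℤ)) + (A (x q) : Set (Fin d → ℤ)) ↔ p y = q := by
    rw [← hBA, ← hx q, funext_iff]
    rfl
  let σ := Finite.equivFin (p '' ⋃₀ T)
  refine ⟨Nat.card (p '' ⋃₀ T), fun i => B (x (σ.symm i)), fun i => A (x (σ.symm i)),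
    fun i => hA _, fun i j hij => ?_, ?_⟩
  · refine Set.disjoint_left.2 fun y hi hj => ?_
    rw [hmem] at hi hj
    exact hij (σ.symm.injective (Subtype.ext (hi.symm.trans hj)))
  · ext y
    simp only [Set.mem_iUnion, hmem]
    constructor
    · intro hy
      exact ⟨σ ⟨p y, y, hy, rfl⟩, by rw [σ.symm_apply_apply]⟩
    · rintro ⟨i, hi⟩
      obtain ⟨L, hL, hxL⟩ := hxS (σ.symm i)
      refine ⟨L, hL, hdet ⟨L, hL⟩ _ _ (fun j => ?_) hxL⟩
      exact congrFun ((hx (σ.symm i)).trans hi.symm) ⟨⟨L, hL⟩, j⟩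

theorem IsAffineStratification.isSemilinearSet {d : ℕ} {W : Set (Fin d → ℤ)}
    (hW : IsAffineStratification W) : IsSemilinearSet W := by
  obtain ⟨r, F, A, hA, -, rfl⟩ := hW
  exact .iUnion fun i => (IsSemilinearSet.of_finite (F i).finite_toSet).add (.of_fg (hA i))

/-- If `W ⊆ ℤ^n` possesses an affine stratification and `φ : ℤ^n → ℤ^d` is a
homomorphism of additive groups, then `φ(W)` possesses an affine stratification. -/
theorem image_isAffineStratification {n d : ℕ}
    (φ : (Fin n → ℤ) →+ (Fin d → ℤ)) (W : Set (Fin n → ℤ))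
    (hW : IsAffineStratification W) :
    IsAffineStratification (φ '' W) :=
  (hW.isSemilinearSet.image φ).isAffineStratification
end
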